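/- arXiv:1302.5658 — 2 statements merged into one kernel-verified Lean document; each statement's English description precedes it below -/
import Mathlib

section
/- If I is a topologically invariant ideal with BP-base on the Hilbert cube I^ω and I is not contained in the meager ideal M, then every closed finite-dimensional subset of I^ω belongs to I. -/
open Set Topology Cardinal

/-- The Hilbert cube `[0,1]^ℕ` with the product topology. -/
abbrev HilbertCube : Type := ℕ → ↥(Set.Icc (0:ℝ) 1)

/-- An ideal of subsets: a nonempty family closed under subsets and finite unions. -/
def IsIdeal {X : Type*} (I : Set (Set X)) : Prop :=
  I.Nonempty ∧ (∀ A ∈ I, ∀ B, B ⊆ A → B ∈ I) ∧ (∀ A ∈ I, ∀ B ∈ I, A ∪ B ∈ I)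

/-- A σ-ideal: an ideal closed under countable unions. -/
def IsSigmaIdeal {X : Type*} (I : Set (Set X)) : Prop :=
  IsIdeal I ∧ ∀ A : ℕ → Set X, (∀ n, A n ∈ I) → (⋃ n, A n) ∈ I

/-- A non-trivial ideal contains an uncountable set but not the whole space. -/
def NontrivialIdeal {X : Type*} (I : Set (Set X)) : Prop :=
  (∃ A ∈ I, ¬ A.Countable) ∧ Set.univ ∉ I

/-- An ideal on a topological space is topologically invariant if it is preserved by
all homeomorphisms of the space. -/
def TopInvariant {X : Type*} [TopologicalSpace X] (I : Set (Set X)) : Prop :=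
  ∀ h : X ≃ₜ X, {B | ∃ A ∈ I, B = h '' A} = I

/-- `I` has a base all of whose members satisfy `P`. -/
def HasBaseWith {X : Type*} (I : Set (Set X)) (P : Set X → Prop) : Prop :=
  ∃ B ⊆ I, (∀ A ∈ I, ∃ C ∈ B, A ⊆ C) ∧ ∀ C ∈ B, P C

/-- A set has the Baire property if it differs from some open set by a meager set. -/
def HasBaireProperty {X : Type*} [TopologicalSpace X] (A : Set X) : Prop :=
  ∃ U : Set X, IsOpen U ∧ IsMeagre ((A \ U) ∪ (U \ A))

/-- The σ-ideal of meager subsets of a topological space. -/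
def MeagerIdeal (X : Type*) [TopologicalSpace X] : Set (Set X) := {A | IsMeagre A}

/-- The σ-ideal generated by a family `F`: all subsets of countable unions of members
of `F`. -/
def sigmaGenerated {X : Type*} (F : Set (Set X)) : Set (Set X) :=
  {A | ∃ S : ℕ → Set X, (∀ n, S n ∈ F) ∧ A ⊆ ⋃ n, S n}

/-- A Cantor set in the Hilbert cube: a subset homeomorphic to the Cantor cube. -/
def IsCantorSet (C : Set HilbertCube) : Prop := Nonempty (C ≃ₜ (ℕ → Bool))

/-- A minimal Cantor set: one that can be mapped into any other Cantor set by an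
ambient homeomorphism. -/
def IsMinimalCantorSet (A : Set HilbertCube) : Prop :=
  IsCantorSet A ∧ ∀ B : Set HilbertCube, IsCantorSet B →
    ∃ h : HilbertCube ≃ₜ HilbertCube, h '' A ⊆ B

/-- The family of all minimal Cantor sets in the Hilbert cube. -/
def CantorFamily : Set (Set HilbertCube) := {A | IsMinimalCantorSet A}

/-- The σ-ideal generated by minimal Cantor sets. -/
def sigmaC0 : Set (Set HilbertCube) := sigmaGenerated CantorFamily

/-- A minimal dense Gδ-subset of the Hilbert cube. -/
def IsMinimalDenseGdelta (A : Set HilbertCube) : Prop :=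
  IsGδ A ∧ Dense A ∧ ∀ B : Set HilbertCube, IsGδ B → Dense B →
    ∃ h : HilbertCube ≃ₜ HilbertCube, h '' A ⊆ B

/-- The family of all minimal dense Gδ-sets in the Hilbert cube. -/
def GdeltaFamily : Set (Set HilbertCube) := {A | IsMinimalDenseGdelta A}

/-- The σ-ideal generated by minimal dense Gδ-sets. -/
def sigmaG0 : Set (Set HilbertCube) := sigmaGenerated GdeltaFamily

/-- `cov(I)`: the least cardinality of a subfamily of `I` covering the space. -/
noncomputable def covIdeal {X : Type*} (I : Set (Set X)) : Cardinal :=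
  sInf {c | ∃ A : Set (Set X), A ⊆ I ∧ ⋃₀ A = Set.univ ∧ c = #A}

/-- `non(I)`: the least cardinality of a subset of the space not in `I`. -/
noncomputable def nonIdeal {X : Type*} (I : Set (Set X)) : Cardinal :=
  sInf {c | ∃ A : Set X, A ∉ I ∧ c = #A}

/-- `add(I,J)`: the least cardinality of a subfamily of `I` whose union is not in `J`. -/
noncomputable def addIdeal2 {X : Type*} (I J : Set (Set X)) : Cardinal :=
  sInf {c | ∃ A : Set (Set X), A ⊆ I ∧ ⋃₀ A ∉ J ∧ c = #A}

/-- `add(I) = add(I,I)`. -/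
noncomputable def addIdeal {X : Type*} (I : Set (Set X)) : Cardinal := addIdeal2 I I

/-- `cof(I,J)`: the least cardinality of a subfamily of `J` cofinal in `I`. -/
noncomputable def cofIdeal2 {X : Type*} (I J : Set (Set X)) : Cardinal :=
  sInf {c | ∃ A : Set (Set X), A ⊆ J ∧ (∀ B ∈ I, ∃ C ∈ A, B ⊆ C) ∧ c = #A}

/-- `cof(I) = cof(I,I)`. -/
noncomputable def cofIdeal {X : Type*} (I : Set (Set X)) : Cardinal := cofIdeal2 I I

/-- The compact-open topology on the homeomorphism group of a space, induced by the
compact-open topology of the space of continuous self-maps. -/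
noncomputable instance homeoGroupTopology (X : Type*) [TopologicalSpace X] :
    TopologicalSpace (X ≃ₜ X) :=
  TopologicalSpace.induced (fun h : X ≃ₜ X => (⟨h, h.continuous⟩ : C(X, X)))
    ContinuousMap.compactOpen

/-- A Z-set: a closed set `A` such that for every open cover `U` of the space there is a
continuous map into the complement of `A` which is `U`-near to the identity. -/
def IsZSet {X : Type*} [TopologicalSpace X] (A : Set X) : Prop :=
  IsClosed A ∧ ∀ U : Set (Set X), (∀ V ∈ U, IsOpen V) → ⋃₀ U = Set.univ →
    ∃ f : C(X, X), (∀ x, f x ∉ A) ∧ ∀ x : X, ∃ V ∈ U, x ∈ V ∧ f x ∈ V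

/-- A σZ-set: a countable union of Z-sets. -/
def IsSigmaZSet {X : Type*} [TopologicalSpace X] (A : Set X) : Prop :=
  ∃ Z : ℕ → Set X, (∀ n, IsZSet (Z n)) ∧ A = ⋃ n, Z n

/-- The cube `[0,1]^n`. -/
abbrev FinCube (n : ℕ) : Type := Fin n → ↥(Set.Icc (0:ℝ) 1)

/-- A `Z_n`-set in the Hilbert cube: a closed set `A` such that maps avoiding `A` are
dense in the space `C([0,1]^n, I^ω)` with the compact-open topology. -/
def IsZnSet (n : ℕ) (A : Set HilbertCube) : Prop :=
  IsClosed A ∧ Dense {f : C(FinCube n, HilbertCube) | ∀ x, f x ∉ A}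

/-- A `Z_ω`-set in the Hilbert cube: a closed set which is a `Z_n`-set for all `n`. -/
def IsZomegaSet (A : Set HilbertCube) : Prop :=
  IsClosed A ∧ ∀ n : ℕ, IsZnSet n A

/-- Covering dimension of a space is at most `n`: every finite open cover has a finite
open refinement (still a cover) in which no point belongs to more than `n+1` members. -/
def CovDimLE (Y : Type*) [TopologicalSpace Y] (n : ℕ) : Prop :=
  ∀ U : Set (Set Y), U.Finite → (∀ V ∈ U, IsOpen V) → ⋃₀ U = Set.univ →
    ∃ V : Set (Set Y), V.Finite ∧ (∀ W ∈ V, IsOpen W) ∧ ⋃₀ V = Set.univ ∧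
      (∀ W ∈ V, ∃ W' ∈ U, W ⊆ W') ∧
      ∀ y : Y, {W ∈ V | y ∈ W}.ncard ≤ n + 1

/-- A `G_δ`-generated topologically invariant ideal on the Hilbert cube. -/
def GdeltaGenerated (I : Set (Set HilbertCube)) : Prop :=
  HasBaseWith I IsSigmaCompact ∧
  ∃ G : Set HilbertCube, IsGδ G ∧
    (∀ K : Set HilbertCube, K ⊆ G → IsCompact K → K ∈ I) ∧
    ∀ A ∈ I, IsCompact A →
      Dense {h : HilbertCube ≃ₜ HilbertCube | h '' A ⊆ G}

/-- A `G_δ*`-generated ideal: a preimage of a `G_δ`-generated ideal under an embedding. -/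
def GdeltaStarGenerated (I : Set (Set HilbertCube)) : Prop :=
  ∃ I' : Set (Set HilbertCube), GdeltaGenerated I' ∧
    ∃ e : HilbertCube → HilbertCube, IsEmbedding e ∧ I = {S | ∃ A ∈ I', S = e ⁻¹' A}

/-- A `σG_δ*`-generated ideal. -/
def SigmaGdeltaStarGenerated (I : Set (Set HilbertCube)) : Prop :=
  ∃ In : ℕ → Set (Set HilbertCube), (∀ n, GdeltaStarGenerated (In n)) ∧
    (∀ n, In n ⊆ I) ∧
    ∀ A ∈ I, ∃ K : ℕ → Set HilbertCube,
      (∀ n, IsCompact (K n) ∧ K n ∈ In n) ∧ A ⊆ ⋃ n, K n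

/-- Baire category in the space of finite tuples of self-homeomorphisms of a compact space. -/
theorem exists_homeomorph_tuple_avoiding {X N α : Type*} [UniformSpace X] [CompactSpace X]
    [T0Space X] [(uniformity X).IsCountablyGenerated] [Fintype N] [Countable α]
    (C : α → Set X) (K : α → N → Set X) (hC : ∀ a, IsCompact (C a))
    (hK : ∀ a j, IsClosed (K a j))
    (H : ∀ a, ∀ V ∈ uniformity X, ∀ h : N → X ≃ₜ X, ∃ g : N → X ≃ₜ X,
      (∀ j x, (g j x, x) ∈ V) ∧ ∀ x ∈ C a, ∃ j, h j (g j x) ∉ K a j) :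
    ∃ h : N → X ≃ₜ X, ∀ a, ∀ x ∈ C a, ∃ j, h j x ∉ K a j := by
  let _ : MetricSpace X := UniformSpace.metricSpace X
  let Z : Set (N → C(X, X) × C(X, X)) :=
    {p | ∀ j, ((p j).1.comp (p j).2 = ContinuousMap.id X) ∧
      ((p j).2.comp (p j).1 = ContinuousMap.id X)}
  have hZ : IsClosed Z := by
    have : Z = ⋂ j, ({p | (p j).1.comp (p j).2 = ContinuousMap.id X} ∩
        {p | (p j).2.comp (p j).1 = ContinuousMap.id X}) := by
      ext p; simp [Z]
    rw [this]
    refine isClosed_iInter fun j => IsClosed.inter ?_ ?_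
    · refine isClosed_eq ?_ continuous_const
      exact ContinuousMap.continuous_comp'.comp (by fun_prop : Continuous
        fun p : N → C(X, X) × C(X, X) => ((p j).2, (p j).1))
    · refine isClosed_eq ?_ continuous_const
      exact ContinuousMap.continuous_comp'.comp (by fun_prop : Continuous
        fun p : N → C(X, X) × C(X, X) => ((p j).1, (p j).2))
  have : CompleteSpace Z := hZ.completeSpace_coe
  let toH : Z → N → X ≃ₜ X := fun p j =>
    { toFun := (p.1 j).1
      invFun := (p.1 j).2
      left_inv := fun x => DFunLike.congr_fun (p.2 j).2 x
      right_inv := fun x => DFunLike.congr_fun (p.2 j).1 x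
      continuous_toFun := (p.1 j).1.continuous
      continuous_invFun := (p.1 j).2.continuous }
  let ofH : (N → X ≃ₜ X) → Z := fun h =>
    ⟨fun j => (⟨h j, (h j).continuous⟩, ⟨(h j).symm, (h j).symm.continuous⟩), fun j =>
      ⟨by ext x; simp, by ext x; simp⟩⟩
  let O : α → Set Z := fun a => {p | ∀ x ∈ C a, ∃ j, (p.1 j).1 x ∉ K a j}
  have hO : ∀ a, IsOpen (O a) := by
    intro a
    let Φ : Z → C(X, N → X) := fun p => ContinuousMap.pi fun j => (p.1 j).1
    have hΦ : Continuous Φ := by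
      refine ContinuousMap.continuous_of_continuous_uncurry _ ?_
      refine continuous_pi fun j => ?_
      have h1 : Continuous fun q : Z × X => ((q.1.1 j).1, q.2) :=
        ((continuous_apply j).comp (continuous_subtype_val.comp continuous_fst)).fst.prodMk
          continuous_snd
      exact (ContinuousEval.continuous_eval (F := C(X, X))).comp h1
    have hU : IsOpen (Set.univ.pi fun j => K a j : Set (N → X))ᶜ :=
      (isClosed_set_pi fun j _ => hK a j).isOpen_compl
    have h2 := (ContinuousMap.isOpen_setOfPred_mapsTo (hC a) hU).preimage hΦ
    convert h2 using 1
    ext p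
    simp [O, Φ, Set.MapsTo]
  have hd : ∀ a, Dense (O a) := by
    intro a p
    rw [Metric.mem_closure_iff]
    intro ε hε
    have huc : ∀ j, UniformContinuous (p.1 j).1 := fun j =>
      CompactSpace.uniformContinuous_of_continuous (p.1 j).1.continuous
    have hV : {q : X × X | dist q.1 q.2 < ε / 2} ∩
        ⋂ j, {q : X × X | dist ((p.1 j).1 q.1) ((p.1 j).1 q.2) < ε / 2} ∈ uniformity X := by
      refine Filter.inter_mem (Metric.dist_mem_uniformity (half_pos hε)) ?_
      rw [Filter.iInter_mem]
      intro j
      exact huc j (Metric.dist_mem_uniformity (half_pos hε))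
    obtain ⟨g, hg1, hg2⟩ := H a _ hV (toH p)
    refine ⟨ofH fun j => (g j).trans (toH p j), ?_, ?_⟩
    · intro x hx
      exact hg2 x hx
    · refine lt_of_le_of_lt ?_ (half_lt_self hε)
      rw [Subtype.dist_eq, dist_pi_le_iff (half_pos hε).le]
      intro j
      rw [Prod.dist_eq]
      refine max_le ?_ ?_
      · rw [ContinuousMap.dist_le (half_pos hε).le]
        intro x
        have := hg1 j x
        simp only [Set.mem_inter_iff, Set.mem_iInter] at this
        rw [dist_comm]
        exact (this.2 j).le
      · rw [ContinuousMap.dist_le (half_pos hε).le]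
        intro x
        have := hg1 j ((g j).symm ((toH p j).symm x))
        simp only [Set.mem_inter_iff, Homeomorph.apply_symm_apply] at this
        exact le_of_lt this.1
  have hD := dense_iInter_of_isOpen hO hd
  have : Nonempty Z := ⟨ofH fun _ => Homeomorph.refl X⟩
  obtain ⟨p, hp⟩ := hD.nonempty
  refine ⟨toH p, fun a x hx => ?_⟩
  exact Set.mem_iInter.1 hp a x hx

/-- An order automorphism of `[0,1]` squeezing `[a, 1 - a]` close to `q`, and moving points by at
most `ε` when `[a, 1 - a]` is only required to be squeezed where it is `ε`-close to `q`. -/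
theorem exists_orderIso_squeeze {a ε η q : ℝ} (ha : 0 < a) (ha1 : a ≤ 1) (hε : 0 ≤ ε)
    (hη : 0 < η) (hq0 : 0 ≤ q) (hq1 : q ≤ 1) :
    ∃ θ : Set.Icc (0:ℝ) 1 ≃o Set.Icc (0:ℝ) 1,
      (∀ t : Set.Icc (0:ℝ) 1, |(θ t : ℝ) - t| ≤ ε) ∧
      ∀ t : Set.Icc (0:ℝ) 1, a ≤ t → t ≤ 1 - a → |(t:ℝ) - q| ≤ ε → |(θ t : ℝ) - q| ≤ η := by
  wlog hη1 : η < 1 generalizing η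
  · obtain ⟨θ, h1, h2⟩ := this (η := 1 / 2) (by norm_num) (by norm_num)
    exact ⟨θ, h1, fun t h3 h4 h5 => (h2 t h3 h4 h5).trans (by linarith)⟩
  have hc : 1 ≤ a⁻¹ := (one_le_inv₀ ha).2 ha1
  have hca : a⁻¹ * a = 1 := inv_mul_cancel₀ ha.ne'
  let g : ℝ → ℝ := fun t =>
    max (max (t - ε) (1 - a⁻¹ * (1 - t))) (min (min (t + ε) (a⁻¹ * t)) q)
  have hgm : Monotone g := by
    intro s t hst
    have : a⁻¹ * s ≤ a⁻¹ * t := by gcongr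
    refine max_le_max (max_le_max (by linarith) (by linarith))
      (min_le_min (min_le_min (by linarith) this) le_rfl)
  have hgc : Continuous g := by fun_prop
  have hg0 : g 0 = 0 := by
    have h1 : max (0 - ε) (1 - a⁻¹ * (1 - 0)) ≤ 0 := max_le (by linarith) (by linarith)
    have h2 : min (min (0 + ε) (a⁻¹ * 0)) q = 0 := by
      rw [mul_zero, zero_add, min_eq_right hε, min_eq_left hq0]
    simp only [g]
    rw [h2, max_eq_right h1]
  have hg1 : g 1 = 1 := by
    have h1 : max (1 - ε) (1 - a⁻¹ * (1 - 1)) = 1 := by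
      rw [sub_self, mul_zero, sub_zero, max_eq_right (by linarith)]
    simp only [g]
    rw [h1, max_eq_left ((min_le_right _ _).trans hq1)]
  have hgε : ∀ t, 0 ≤ t → t ≤ 1 → |g t - t| ≤ ε := by
    intro t h0 h1
    have h2 : t - ε ≤ g t := (le_max_left _ _).trans (le_max_left _ _)
    have h3 : g t ≤ t + ε := by
      refine max_le (max_le (by linarith) ?_) ((min_le_left _ _).trans (min_le_left _ _))
      nlinarith
    rw [abs_le]; constructor <;> linarith
  have hgq : ∀ t, a ≤ t → t ≤ 1 - a → |t - q| ≤ ε → g t = q := by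
    intro t h0 h1 h2
    rw [abs_le] at h2
    have h3 : 1 ≤ a⁻¹ * t := by rw [← hca]; gcongr
    have h4 : 1 ≤ a⁻¹ * (1 - t) := by rw [← hca]; gcongr; linarith
    have h5 : min (min (t + ε) (a⁻¹ * t)) q = q :=
      min_eq_right (le_min (by linarith) (by linarith))
    have h6 : max (t - ε) (1 - a⁻¹ * (1 - t)) ≤ q := max_le (by linarith) (by linarith)
    simp only [g]
    rw [h5, max_eq_right h6]
  let f : ℝ → ℝ := fun t => (1 - η) * g t + η * t
  have hfm : StrictMono f := by
    intro s t hst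
    have := hgm hst.le
    simp only [f]
    have h1 : (1 - η) * g s ≤ (1 - η) * g t := by
      apply mul_le_mul_of_nonneg_left this; linarith
    have h2 : η * s < η * t := by gcongr
    linarith
  have hfc : Continuous f := by fun_prop
  have hf0 : f 0 = 0 := by simp [f, hg0]
  have hf1 : f 1 = 1 := by simp [f, hg1]
  let F : Set.Icc (0:ℝ) 1 → Set.Icc (0:ℝ) 1 := fun t =>
    ⟨f t, hf0.ge.trans (hfm.monotone t.2.1), (hfm.monotone t.2.2).trans hf1.le⟩
  have hFm : StrictMono F := fun s t hst => hfm hst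
  have hFs : Function.Surjective F := by
    intro y
    obtain ⟨t, ht, hty⟩ := intermediate_value_Icc (zero_le_one' ℝ) hfc.continuousOn
      (show (y:ℝ) ∈ Set.Icc (f 0) (f 1) by rw [hf0, hf1]; exact y.2)
    exact ⟨⟨t, ht⟩, Subtype.ext hty⟩
  refine ⟨hFm.orderIsoOfSurjective F hFs, fun t => ?_, fun t h0 h1 h2 => ?_⟩
  · change |(1 - η) * g t + η * t - t| ≤ ε
    have h3 := hgε t t.2.1 t.2.2
    have h4 : (1 - η) * g t + η * t - t = (1 - η) * (g t - t) := by ring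
    rw [h4, abs_mul, abs_of_pos (by linarith)]
    nlinarith [abs_nonneg (g t - t)]
  · change |(1 - η) * g t + η * t - q| ≤ η
    rw [hgq t h0 h1 h2]
    have h4 : (1 - η) * q + η * t - q = η * (t - q) := by ring
    rw [h4, abs_mul, abs_of_pos hη]
    have : |(t:ℝ) - q| ≤ 1 := by
      have := t.2.1; have := t.2.2
      rw [abs_le]; constructor <;> linarith
    nlinarith

/-- A homeomorphism of the Hilbert cube fixing the coordinates in `A` and acting on the other
coordinates by convex combinations of order automorphisms, with weights depending only on the
coordinates in `A`. -/
theorem exists_skew_homeomorph {ι : Type*} [Fintype ι] (A : Set ℕ) (l : ι → HilbertCube → ℝ)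
    (hlc : ∀ k, Continuous (l k)) (hl0 : ∀ k x, 0 ≤ l k x) (hl1 : ∀ x, ∑ k, l k x = 1)
    (hlA : ∀ k x y, (∀ i ∈ A, x i = y i) → l k x = l k y)
    (θ : ι → ℕ → Set.Icc (0:ℝ) 1 ≃o Set.Icc (0:ℝ) 1) :
    ∃ h : HilbertCube ≃ₜ HilbertCube, (∀ x, ∀ i ∈ A, h x i = x i) ∧
      ∀ x, ∀ i ∉ A, (h x i : ℝ) = ∑ k, l k x * θ k i (x i) := by
  classical
  have hmem : ∀ x i, (t : Set.Icc (0:ℝ) 1) → ∑ k, l k x * (θ k i t : ℝ) ∈ Set.Icc (0:ℝ) 1 := by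
    intro x i t
    refine ⟨Finset.sum_nonneg fun k _ => mul_nonneg (hl0 k x) (θ k i t).2.1, ?_⟩
    exact (Finset.sum_le_sum fun k _ =>
      mul_le_of_le_one_right (hl0 k x) (θ k i t).2.2).trans (hl1 x).le
  let f : HilbertCube → HilbertCube := fun x i =>
    if i ∈ A then x i else ⟨∑ k, l k x * (θ k i (x i) : ℝ), hmem x i (x i)⟩
  have hfA : ∀ x, ∀ i ∈ A, f x i = x i := fun x i hi => by simp only [f, if_pos hi]
  have hfn : ∀ x, ∀ i ∉ A, (f x i : ℝ) = ∑ k, l k x * θ k i (x i) := fun x i hi => by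
    simp only [f, if_neg hi]
  have hθc : ∀ k i, Continuous (θ k i) := fun k i => (θ k i).continuous
  have hcont : Continuous f := by
    refine continuous_pi fun i => ?_
    by_cases hi : i ∈ A
    · simp only [f, if_pos hi]; fun_prop
    · simp only [f, if_neg hi]; fun_prop
  have hmono : ∀ x i, StrictMono fun t : Set.Icc (0:ℝ) 1 => ∑ k, l k x * (θ k i t : ℝ) := by
    intro x i s t hst
    have hle : ∀ k ∈ Finset.univ, l k x * (θ k i s : ℝ) ≤ l k x * (θ k i t : ℝ) := fun k _ =>
      mul_le_mul_of_nonneg_left ((θ k i).monotone hst.le) (hl0 k x)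
    refine Finset.sum_lt_sum hle ?_
    by_contra! hcon
    have : ∀ k, l k x = 0 := by
      intro k
      by_contra hne
      have h1 : (θ k i s : ℝ) < θ k i t := (θ k i).strictMono hst
      have h2 := hcon k (Finset.mem_univ k)
      have h3 : 0 < l k x := lt_of_le_of_ne (hl0 k x) (Ne.symm hne)
      nlinarith
    have h4 := hl1 x
    simp [this] at h4
  have hinj : Function.Injective f := by
    intro x y hxy
    have hA : ∀ i ∈ A, x i = y i := fun i hi => by rw [← hfA x i hi, hxy, hfA y i hi]
    funext i
    by_cases hi : i ∈ A
    · exact hA i hi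
    · apply (hmono x i).injective
      have h1 := hfn x i hi
      rw [hxy, hfn y i hi] at h1
      simp only [← h1]
      exact Finset.sum_congr rfl fun k _ => by rw [hlA k x y hA]
  have hsurj : Function.Surjective f := by
    intro y
    have : ∀ i, ∃ t : Set.Icc (0:ℝ) 1, ∑ k, l k y * (θ k i t : ℝ) = y i := by
      intro i
      have hc : Continuous fun t : Set.Icc (0:ℝ) 1 => ∑ k, l k y * (θ k i t : ℝ) := by fun_prop
      refine mem_range_of_exists_le_of_exists_ge hc ⟨⊥, ?_⟩ ⟨⊤, ?_⟩
      · simp only [OrderIso.map_bot]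
        simpa using (y i).2.1
      · simp only [OrderIso.map_top]
        simpa [hl1 y] using (y i).2.2
    choose t ht using this
    let x : HilbertCube := fun i => if i ∈ A then y i else t i
    have hxA : ∀ i ∈ A, x i = y i := fun i hi => by simp only [x, if_pos hi]
    refine ⟨x, funext fun i => ?_⟩
    by_cases hi : i ∈ A
    · rw [hfA x i hi, hxA i hi]
    · apply Subtype.ext
      rw [hfn x i hi, ← ht i]
      have : x i = t i := by simp only [x, if_neg hi]
      rw [this]
      exact Finset.sum_congr rfl fun k _ => by rw [hlA k x y hxA]
  have hc' : Continuous (Equiv.ofBijective f ⟨hinj, hsurj⟩) := hcont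
  exact ⟨hc'.homeoOfEquivCompactToT2, hfA, hfn⟩

/-- The sup-norm of the first `M + 1` coordinates of a sequence. -/
noncomputable def headNorm (M : ℕ) (y : ℕ → ℝ) : ℝ := ‖fun j : Fin (M + 1) => y j‖

/-- The linear shear adding `c` times coordinate `i` to coordinate `M`. -/
def shear (i M : ℕ) (c : ℝ) (y : ℕ → ℝ) : ℕ → ℝ := fun j => if j = M then y M + c * y i else y j

/-- The shear `shear i M c`, rescaled on the first `M + 1` coordinates so as to preserve
`headNorm M`. -/
noncomputable def scaledShear (i M : ℕ) (c : ℝ) (y : ℕ → ℝ) : ℕ → ℝ := fun j =>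
  if j ≤ M then headNorm M y / headNorm M (shear i M c y) * shear i M c y j else y j

theorem headNorm_nonneg (M : ℕ) (y : ℕ → ℝ) : 0 ≤ headNorm M y := norm_nonneg _

theorem abs_le_headNorm {M j : ℕ} (hj : j ≤ M) (y : ℕ → ℝ) : |y j| ≤ headNorm M y :=
  norm_le_pi_norm (fun j : Fin (M + 1) => y j) ⟨j, by omega⟩

theorem headNorm_le {M : ℕ} {y : ℕ → ℝ} {r : ℝ} (hr : 0 ≤ r) (h : ∀ j ≤ M, |y j| ≤ r) :
    headNorm M y ≤ r :=
  (pi_norm_le_iff_of_nonneg hr).2 fun j => h j (by omega)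

theorem headNorm_congr {M : ℕ} {y z : ℕ → ℝ} (h : ∀ j ≤ M, y j = z j) :
    headNorm M y = headNorm M z := by
  unfold headNorm
  congr 1
  funext j
  exact h j (by omega)

theorem headNorm_smul (M : ℕ) (c : ℝ) (y : ℕ → ℝ) :
    headNorm M (fun j => c * y j) = |c| * headNorm M y :=
  norm_smul c fun j : Fin (M + 1) => y j

theorem continuous_headNorm (M : ℕ) : Continuous (headNorm M) := by
  unfold headNorm; fun_prop

theorem continuous_shear (i M : ℕ) (c : ℝ) : Continuous (shear i M c) := by
  refine continuous_pi fun j => ?_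
  unfold shear
  split_ifs <;> fun_prop

theorem shear_congr {i M : ℕ} (hi : i < M) (c : ℝ) {y z : ℕ → ℝ} (h : ∀ j ≤ M, y j = z j) :
    ∀ j ≤ M, shear i M c y j = shear i M c z j := by
  intro j hj
  simp only [shear, h j hj, h M le_rfl, h i hi.le]

theorem shear_smul (i M : ℕ) (c r : ℝ) (y : ℕ → ℝ) :
    shear i M c (fun j => r * y j) = fun j => r * shear i M c y j := by
  funext j
  simp only [shear]
  split_ifs <;> ring

theorem shear_neg_shear {i M : ℕ} (hi : i < M) (c : ℝ) (y : ℕ → ℝ) :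
    shear i M (-c) (shear i M c y) = y := by
  funext j
  simp only [shear]
  split_ifs with h1 h2
  · omega
  · rw [h1]; simp
  · rfl

theorem headNorm_eq_zero {M : ℕ} {y : ℕ → ℝ} (h : headNorm M y = 0) : ∀ j ≤ M, y j = 0 :=
  fun _ hj => abs_eq_zero.1 (le_antisymm ((abs_le_headNorm hj y).trans h.le) (abs_nonneg _))

theorem headNorm_shear_eq_zero {i M : ℕ} (hi : i < M) {c : ℝ} {y : ℕ → ℝ}
    (h : headNorm M (shear i M c y) = 0) : headNorm M y = 0 := by
  refine le_antisymm (headNorm_le le_rfl fun j hj => ?_) (headNorm_nonneg _ _)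
  have h1 := shear_congr hi (-c) (z := fun _ => 0) (headNorm_eq_zero h) j hj
  rw [shear_neg_shear hi] at h1
  rw [h1]
  simp [shear]

theorem scaledShear_of_le {i M j : ℕ} (hj : j ≤ M) (c : ℝ) (y : ℕ → ℝ) :
    scaledShear i M c y j = headNorm M y / headNorm M (shear i M c y) * shear i M c y j :=
  if_pos hj

theorem scaledShear_of_lt {i M j : ℕ} (hj : M < j) (c : ℝ) (y : ℕ → ℝ) :
    scaledShear i M c y j = y j :=
  if_neg (by omega)

theorem headNorm_scaledShear {i M : ℕ} (hi : i < M) (c : ℝ) (y : ℕ → ℝ) :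
    headNorm M (scaledShear i M c y) = headNorm M y := by
  rw [headNorm_congr fun _ hj => scaledShear_of_le hj c y, headNorm_smul, abs_of_nonneg
    (div_nonneg (headNorm_nonneg _ _) (headNorm_nonneg _ _))]
  by_cases h : headNorm M (shear i M c y) = 0
  · rw [h, headNorm_shear_eq_zero hi h]; simp
  · exact div_mul_cancel₀ _ h

theorem scaledShear_neg_scaledShear {i M : ℕ} (hi : i < M) (c : ℝ) (y : ℕ → ℝ) :
    scaledShear i M (-c) (scaledShear i M c y) = y := by
  funext j
  rcases lt_or_ge M j with hj | hj
  · rw [scaledShear_of_lt hj, scaledShear_of_lt hj]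
  · rw [scaledShear_of_le hj, headNorm_scaledShear hi]
    have h1 := shear_congr hi (-c) fun _ hj => scaledShear_of_le (i := i) hj c y
    rw [headNorm_congr h1, h1 j hj, shear_smul, headNorm_smul, shear_neg_shear hi]
    by_cases h : headNorm M y = 0
    · rw [h, headNorm_eq_zero h j hj]; simp
    · have h2 : headNorm M (shear i M c y) ≠ 0 := fun h2 => h (headNorm_shear_eq_zero hi h2)
      rw [abs_of_nonneg (div_nonneg (headNorm_nonneg _ _) (headNorm_nonneg _ _))]
      field_simp

theorem continuous_scaledShear {i M : ℕ} (hi : i < M) (c : ℝ) : Continuous (scaledShear i M c) := by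
  refine continuous_pi fun j => ?_
  rcases lt_or_ge M j with hj | hj
  · simp only [scaledShear_of_lt hj]; fun_prop
  · rw [continuous_iff_continuousAt]
    intro y
    by_cases h : headNorm M y = 0
    · have h0 : scaledShear i M c y j = 0 := by rw [scaledShear_of_le hj, h]; simp
      rw [ContinuousAt, h0]
      refine squeeze_zero_norm (a := headNorm M) (fun z => ?_) ?_
      · rw [← headNorm_scaledShear hi c z]
        exact abs_le_headNorm hj _
      · rw [← h]; exact (continuous_headNorm M).continuousAt
    · have h2 : headNorm M (shear i M c y) ≠ 0 := fun h2 => h (headNorm_shear_eq_zero hi h2)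
      simp only [scaledShear_of_le hj]
      refine ContinuousAt.mul (ContinuousAt.div (continuous_headNorm M).continuousAt
        ((continuous_headNorm M).comp (continuous_shear i M c)).continuousAt h2) ?_
      exact ((continuous_apply j).comp (continuous_shear i M c)).continuousAt

theorem abs_scaledShear_sub_le {i M j : ℕ} (hi : i < M) (hj : j < M) {c : ℝ} (hc : |c| ≤ 1 / 2)
    {y : ℕ → ℝ} (hy : ∀ k, |y k| ≤ 1) : |scaledShear i M c y j - y j| ≤ 2 * |c| := by
  have hs : shear i M c y j = y j := if_neg (by omega)
  rw [scaledShear_of_le hj.le, hs]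
  set n := headNorm M y with hn
  set m := headNorm M (shear i M c y) with hm
  have hn0 : 0 ≤ n := headNorm_nonneg _ _
  have hyi : |c * y i| ≤ |c| * n := by
    rw [abs_mul]; exact mul_le_mul_of_nonneg_left (abs_le_headNorm hi.le y) (abs_nonneg c)
  have hc0 := abs_nonneg c
  have h1 : m ≤ n + |c| * n := by
    refine headNorm_le (by positivity) fun k hk => ?_
    unfold shear
    split_ifs with h
    · exact (abs_add_le _ _).trans (add_le_add (abs_le_headNorm le_rfl y) hyi)
    · exact (abs_le_headNorm hk y).trans (by nlinarith)
  have h2 : n ≤ m + |c| * n := by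
    have hm0 : 0 ≤ m := headNorm_nonneg _ _
    refine headNorm_le (by positivity) fun k hk => ?_
    have h3 := abs_le_headNorm hk (shear i M c y)
    rw [← hm] at h3
    unfold shear at h3
    split_ifs at h3 with h
    · have : y k = (y M + c * y i) + (-(c * y i)) := by rw [h]; ring
      rw [this]
      exact (abs_add_le _ _).trans (add_le_add h3 (by rwa [abs_neg]))
    · exact h3.trans (by nlinarith)
  rcases hn0.eq_or_lt with h0 | h0
  · rw [headNorm_eq_zero h0.symm j hj.le]; simp
  · have hm0 : 0 < m := by nlinarith
    have h4 : n / m * y j - y j = (n - m) / m * y j := by field_simp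
    rw [h4, abs_mul]
    have h5 : |(n - m) / m| ≤ 2 * |c| := by
      rw [abs_div, abs_of_pos hm0, div_le_iff₀ hm0, abs_le]
      constructor <;> nlinarith
    nlinarith [hy j, abs_nonneg (y j), abs_nonneg ((n - m) / m)]

theorem exists_homeomorph_scaledShear {i M : ℕ} (hi : i < M) (c : ℝ) :
    ∃ R : HilbertCube ≃ₜ HilbertCube, ∀ x j,
      2 * (R x j : ℝ) - 1 = scaledShear i M c (fun k => 2 * (x k : ℝ) - 1) j := by
  have hu : ∀ (x : HilbertCube) k, |2 * (x k : ℝ) - 1| ≤ 1 := fun x k => by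
    have := (x k).2.1; have := (x k).2.2
    rw [abs_le]; constructor <;> linarith
  have hb : ∀ (c : ℝ) (x : HilbertCube) j,
      |scaledShear i M c (fun k => 2 * (x k : ℝ) - 1) j| ≤ 1 := by
    intro c x j
    rcases lt_or_ge M j with hj | hj
    · rw [scaledShear_of_lt hj]; exact hu x j
    · refine (abs_le_headNorm hj _).trans ?_
      rw [headNorm_scaledShear hi]
      exact headNorm_le zero_le_one fun k _ => hu x k
  let f : ℝ → HilbertCube → HilbertCube := fun c x j =>
    ⟨(1 + scaledShear i M c (fun k => 2 * (x k : ℝ) - 1) j) / 2, by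
      have := abs_le.1 (hb c x j)
      constructor <;> linarith⟩
  have hf : ∀ c x j, 2 * (f c x j : ℝ) - 1 = scaledShear i M c (fun k => 2 * (x k : ℝ) - 1) j :=
    fun c x j => by simp only [f]; ring
  have hfc : ∀ c, Continuous (f c) := by
    intro c
    refine continuous_pi fun j => Continuous.subtype_mk ?_ _
    have := (continuous_apply j).comp ((continuous_scaledShear hi c).comp
      (by fun_prop : Continuous fun (x : HilbertCube) k => 2 * (x k : ℝ) - 1))
    exact (continuous_const.add this).div_const 2
  have hinv : ∀ c x, f (-c) (f c x) = x := by
    intro c x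
    funext j
    apply Subtype.ext
    have h1 := hf (-c) (f c x) j
    rw [funext (hf c x), scaledShear_neg_scaledShear hi] at h1
    linarith
  exact ⟨{ toFun := f c
           invFun := f (-c)
           left_inv := hinv c
           right_inv := fun x => by simpa using hinv (-c) x
           continuous_toFun := hfc c
           continuous_invFun := hfc (-c) }, hf c⟩

/-- A set `C` is pushable if small homeomorphisms move it so that any prescribed finite number of
coordinates take values in the open interval `(0, 1)`. -/
def IsPushable (C : Set HilbertCube) : Prop :=
  ∀ ε > 0, ∀ M : ℕ, ∃ h : HilbertCube ≃ₜ HilbertCube,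
    (∀ x, ∀ j < M, |(h x j : ℝ) - x j| ≤ ε) ∧
    ∀ x ∈ C, ∀ j < M, 0 < (h x j : ℝ) ∧ (h x j : ℝ) < 1

theorem IsPushable.mono {C D : Set HilbertCube} (hD : IsPushable D) (h : C ⊆ D) : IsPushable C :=
  fun ε hε M => (hD ε hε M).imp fun _ hκ => ⟨hκ.1, fun x hx => hκ.2 x (h hx)⟩

theorem isPushable_of_interior {C : Set HilbertCube}
    (hC : ∀ x ∈ C, ∀ j, 0 < (x j : ℝ) ∧ (x j : ℝ) < 1) : IsPushable C :=
  fun _ hε _ => ⟨Homeomorph.refl _, fun x j _ => by simpa using hε.le, fun x hx j _ => hC x hx j⟩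

/-- Squeezing a single coordinate towards `1`. -/
theorem exists_homeomorph_squeeze_coordinate (M : ℕ) {a η : ℝ} (ha : 0 < a) (ha1 : a ≤ 1 / 2)
    (hη : 0 < η) : ∃ S : HilbertCube ≃ₜ HilbertCube, (∀ x, ∀ j ≠ M, S x j = x j) ∧
      ∀ x, a ≤ (x M : ℝ) → 1 - η ≤ (S x M : ℝ) := by
  obtain ⟨θ, -, hθ⟩ := exists_orderIso_squeeze (q := 1) ha (by linarith) zero_le_one hη
    zero_le_one le_rfl
  obtain ⟨S, hS1, hS2⟩ := exists_skew_homeomorph {M}ᶜ (fun (_ : Unit) _ => 1)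
    (fun _ => continuous_const) (fun _ _ => zero_le_one) (by simp) (by simp) (fun _ _ => θ)
  refine ⟨S, fun x j hj => hS1 x j hj, fun x hx => ?_⟩
  have h1 := hS2 x M (by simp)
  simp only [Finset.univ_unique, Finset.sum_singleton, one_mul] at h1
  rw [h1]
  have h2 := hθ ⟨a, ha.le, by linarith⟩ le_rfl (by simp only; linarith) (by
    simp only; rw [abs_le]; constructor <;> linarith)
  have h3 : (θ ⟨a, ha.le, by linarith⟩ : ℝ) ≤ θ (x M) := θ.monotone hx
  have := (abs_le.1 h2).1
  linarith

/-- The faces of the Hilbert cube are pushable. -/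
theorem isPushable_face (i : ℕ) {s : ℝ} (hs : |s| = 1) :
    IsPushable {x | 2 * (x i : ℝ) - 1 = s} := by
  intro ε hε M₀
  obtain ⟨M, hM₀, hi⟩ : ∃ M, M₀ ≤ M ∧ i < M := ⟨max M₀ (i + 1), le_max_left _ _, by omega⟩
  obtain ⟨δ, hδ0, hδε, hδ1⟩ : ∃ δ > 0, δ ≤ ε / 2 ∧ δ ≤ 1 / 4 :=
    ⟨min (ε / 2) (1 / 4), by positivity, min_le_left _ _, min_le_right _ _⟩
  have hss : s * s = 1 := by
    rw [← sq, ← sq_abs, hs, one_pow]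
  obtain ⟨R, hR⟩ := exists_homeomorph_scaledShear hi (s * δ)
  obtain ⟨S, hS1, hS2⟩ := exists_homeomorph_squeeze_coordinate M (a := δ / 2) (η := δ / 4)
    (by linarith) (by linarith) (by linarith)
  have hu : ∀ (x : HilbertCube) k, |2 * (x k : ℝ) - 1| ≤ 1 := fun x k => by
    have := (x k).2.1; have := (x k).2.2
    rw [abs_le]; constructor <;> linarith
  have hcabs : |s * δ| = δ := by rw [abs_mul, hs, one_mul, abs_of_pos hδ0]
  have hRn : ∀ x, ∀ j < M, |(R x j : ℝ) - x j| ≤ δ := by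
    intro x j hj
    have h1 := abs_scaledShear_sub_le hi hj (c := s * δ) (by rw [hcabs]; linarith) (hu x)
    rw [← hR, hcabs] at h1
    have h2 : 2 * (R x j : ℝ) - 1 - (2 * (x j : ℝ) - 1) = 2 * ((R x j : ℝ) - x j) := by ring
    rw [h2, abs_mul, abs_two] at h1
    linarith
  refine ⟨(R.trans S).trans R, fun x j hj => ?_, fun x hx j hj => ?_⟩
  · simp only [Homeomorph.trans_apply]
    have h1 := hRn (S (R x)) j (by omega)
    rw [hS1 _ j (by omega)] at h1
    have h2 := hRn x j (by omega)
    calc _ ≤ |(R (S (R x)) j : ℝ) - R x j| + |(R x j : ℝ) - x j| := abs_sub_le _ _ _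
      _ ≤ ε := by linarith
  · simp only [Homeomorph.trans_apply]
    set u : ℕ → ℝ := fun k => 2 * (x k : ℝ) - 1 with hu'
    have hui : u i = s := hx
    set v : ℕ → ℝ := fun k => 2 * (R x k : ℝ) - 1 with hv'
    set w : ℕ → ℝ := fun k => 2 * (S (R x) k : ℝ) - 1 with hw'
    have hnu : headNorm M u = 1 := by
      refine le_antisymm (headNorm_le zero_le_one fun k _ => hu x k) ?_
      rw [← hs, ← hui]; exact abs_le_headNorm hi.le u
    set m := headNorm M (shear i M (s * δ) u) with hm
    have hm1 : 1 ≤ m := by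
      have h1 := abs_le_headNorm hi.le (shear i M (s * δ) u)
      have h2 : shear i M (s * δ) u i = u i := if_neg (by omega)
      rwa [h2, hui, hs] at h1
    have hm2 : m ≤ 1 + δ := by
      refine headNorm_le (by linarith) fun k hk => ?_
      unfold shear
      split_ifs
      · refine (abs_add_le _ _).trans ?_
        rw [hui, abs_mul, hcabs, hs, mul_one]
        linarith [hu x M]
      · linarith [hu x k]
    have hvi : v i = s / m := by
      have h1 := hR x i
      rw [scaledShear_of_le hi.le, hnu, ← hm] at h1
      have h2 : shear i M (s * δ) u i = u i := if_neg (by omega)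
      rw [h2, hui] at h1
      simp only [hv', h1]; ring
    have hvM : -1 + δ ≤ v M := by
      have h1 := hR x M
      rw [scaledShear_of_le le_rfl, hnu, ← hm] at h1
      have h2 : shear i M (s * δ) u M = u M + δ := by
        simp only [shear, if_true, hui]
        linear_combination δ * hss
      rw [h2] at h1
      simp only [hv', h1]
      rw [one_div, inv_mul_eq_div, le_div_iff₀ (by linarith)]
      have := (abs_le.1 (hu x M)).1
      simp only [hu']
      nlinarith
    have hwv : ∀ k ≠ M, w k = v k := fun k hk => by simp only [hw', hv', hS1 _ k hk]
    have hwM : 1 - δ / 2 ≤ w M := by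
      have h1 := hS2 (R x) (by simp only [hv'] at hvM; linarith)
      simp only [hw']; linarith
    have hnw : headNorm M w ≤ 1 := headNorm_le zero_le_one fun k _ => hu _ k
    have hbig : 1 < headNorm M (shear i M (s * δ) w) := by
      have h1 := abs_le_headNorm (le_refl M) (shear i M (s * δ) w)
      have h2 : shear i M (s * δ) w M = w M + δ / m := by
        simp only [shear, if_true, hwv i hi.ne, hvi]
        linear_combination (δ / m) * hss
      rw [h2] at h1
      have h3 : δ * (4 / 5) ≤ δ / m := by
        rw [le_div_iff₀ (by linarith)]; nlinarith
      have := le_abs_self (w M + δ / m)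
      linarith
    have hfin : |2 * (R (S (R x)) j : ℝ) - 1| < 1 := by
      rw [hR, scaledShear_of_le (by omega), div_mul_eq_mul_div, abs_div,
        abs_of_pos (by linarith : (0:ℝ) < headNorm M (shear i M (s * δ) w)),
        div_lt_one (by linarith), abs_mul]
      have h2 : shear i M (s * δ) w j = w j := if_neg (by omega)
      rw [h2, abs_of_nonneg (headNorm_nonneg _ _)]
      have h3 : |w j| ≤ 1 := hu _ j
      nlinarith [headNorm_nonneg M w, abs_nonneg (w j)]
    rw [abs_lt] at hfin
    constructor <;> linarith

theorem isPushable_singleton (x : HilbertCube) : IsPushable {x} := by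
  by_cases h : ∀ j, 0 < (x j : ℝ) ∧ (x j : ℝ) < 1
  · exact isPushable_of_interior (by simpa using h)
  · push Not at h
    obtain ⟨i, hi⟩ := h
    have h0 := (x i).2.1
    have h1 := (x i).2.2
    rcases h0.eq_or_lt with h2 | h2
    · refine (isPushable_face i (s := -1) (by simp)).mono ?_
      rw [Set.singleton_subset_iff, Set.mem_ofPred_eq, ← h2]; norm_num
    · refine (isPushable_face i (s := 1) (by simp)).mono ?_
      have : (x i : ℝ) = 1 := le_antisymm h1 (hi h2)
      rw [Set.singleton_subset_iff, Set.mem_ofPred_eq, this]; norm_num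

theorem exists_weights {P ι : Type*} [TopologicalSpace P] [NormalSpace P] [ParacompactSpace P]
    [Fintype ι] [Nonempty ι] (D : ι → Set P) (hD : ∀ k, IsClosed (D k))
    (hdis : Pairwise fun k l => Disjoint (D k) (D l)) :
    ∃ w : ι → P → ℝ, (∀ k, Continuous (w k)) ∧ (∀ k x, 0 ≤ w k x) ∧ (∀ x, ∑ k, w k x = 1) ∧
      ∀ k, ∀ x ∈ D k, w k x = 1 := by
  classical
  let U : ι → Set P := fun k => ⋂ l, ⋂ (_ : l ≠ k), (D l)ᶜ
  have hU : ∀ k, IsOpen (U k) := fun k =>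
    isOpen_iInter_of_finite fun l => isOpen_iInter_of_finite fun _ => (hD l).isOpen_compl
  have hcov : (Set.univ : Set P) ⊆ ⋃ k, U k := by
    intro x _
    rw [Set.mem_iUnion]
    by_cases h : ∃ k, x ∈ D k
    · obtain ⟨k, hk⟩ := h
      refine ⟨k, ?_⟩
      simp only [U, Set.mem_iInter]
      exact fun l hl hxl => Set.disjoint_left.1 (hdis hl) hxl hk
    · push Not at h
      refine ⟨Classical.arbitrary ι, ?_⟩
      simp only [U, Set.mem_iInter]
      exact fun l _ => h l
  obtain ⟨f, hf⟩ := PartitionOfUnity.exists_isSubordinate isClosed_univ U hU hcov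
  have hsum : ∀ x, ∑ k, f k x = 1 := fun x => by
    rw [← finsum_eq_sum_of_fintype]; exact f.sum_eq_one (Set.mem_univ x)
  refine ⟨fun k x => f k x, fun k => (f k).continuous, fun k x => f.nonneg k x, hsum, ?_⟩
  intro k x hx
  have h0 : ∑ l, f l x = f k x := by
    refine Finset.sum_eq_single k (fun l _ hl => ?_) fun h => absurd (Finset.mem_univ k) h
    by_contra hne
    have h1 : x ∈ U l := hf l (subset_tsupport _ hne)
    simp only [U, Set.mem_iInter] at h1
    exact h1 k (Ne.symm hl) hx
  exact h0.symm.trans (hsum x)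

theorem sum_mul_eq_of_weight_eq_one {ι : Type*} [Fintype ι] {w a : ι → ℝ} (h0 : ∀ k, 0 ≤ w k)
    (h1 : ∑ k, w k = 1) {k : ι} (hk : w k = 1) : ∑ l, w l * a l = a k := by
  classical
  have hz : ∀ l, l ≠ k → w l = 0 := by
    intro l hl
    have h2 := Finset.add_sum_erase Finset.univ w (Finset.mem_univ k)
    rw [h1, hk] at h2
    have h3 : ∑ l ∈ Finset.univ.erase k, w l = 0 := by linarith
    exact (Finset.sum_eq_zero_iff_of_nonneg fun l _ => h0 l).1 h3 l (by simp [hl])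
  rw [Finset.sum_eq_single k (fun l _ hl => by rw [hz l hl, zero_mul]) (by simp), hk, one_mul]

theorem abs_sum_mul_sub_le {ι : Type*} [Fintype ι] {w a : ι → ℝ} (h0 : ∀ k, 0 ≤ w k)
    (h1 : ∑ k, w k = 1) {b ε : ℝ} (h : ∀ k, |a k - b| ≤ ε) : |∑ k, w k * a k - b| ≤ ε := by
  have h2 : ∑ k, w k * a k - b = ∑ k, w k * (a k - b) := by
    simp only [mul_sub, Finset.sum_sub_distrib, ← Finset.sum_mul, h1, one_mul]
  rw [h2]
  calc |∑ k, w k * (a k - b)| ≤ ∑ k, |w k * (a k - b)| := Finset.abs_sum_le_sum_abs _ _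
    _ ≤ ∑ k, w k * ε := Finset.sum_le_sum fun k _ => by
        rw [abs_mul, abs_of_nonneg (h0 k)]
        exact mul_le_mul_of_nonneg_left (h k) (h0 k)
    _ = ε := by rw [← Finset.sum_mul, h1, one_mul]

theorem exists_coordinates_of_mem_uniformity {V : Set (HilbertCube × HilbertCube)}
    (hV : V ∈ uniformity HilbertCube) : ∃ (M : ℕ) (ε : ℝ), 0 < ε ∧ ∀ x y : HilbertCube,
      (∀ j < M, |(x j : ℝ) - y j| ≤ ε) → (x, y) ∈ V := by
  rw [Pi.uniformity, Filter.mem_iInf] at hV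
  obtain ⟨I, hI, W, hW, rfl⟩ := hV
  have h1 : ∀ i : I, ∃ ε > 0, ∀ x y : HilbertCube, |(x i : ℝ) - y i| < ε → (x, y) ∈ W i := by
    intro i
    obtain ⟨t, ht, hts⟩ := Filter.mem_comap.1 (hW i)
    obtain ⟨ε, hε, hεt⟩ := Metric.mem_uniformity_dist.1 ht
    exact ⟨ε, hε, fun x y hxy => hts (hεt hxy)⟩
  choose ε hε hεW using h1
  have : Finite I := hI
  obtain ⟨M, hM⟩ := hI.bddAbove
  have h2 : ∀ᶠ r in 𝓝[>] (0:ℝ), ∀ i : I, r < ε i :=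
    Filter.eventually_all.2 fun i => Filter.Eventually.filter_mono nhdsWithin_le_nhds
      (eventually_lt_nhds (hε i))
  obtain ⟨r, hr, hr0⟩ := (h2.and self_mem_nhdsWithin).exists
  refine ⟨M + 1, r, hr0, fun x y hxy => Set.mem_iInter.2 fun i => hεW i x y ?_⟩
  exact (hxy i (Nat.lt_succ_of_le (hM i.2))).trans_lt (hr i)

theorem exists_coordinates_of_isOpen {U : Set HilbertCube} (hU : IsOpen U) {p : HilbertCube}
    (hp : p ∈ U) : ∃ (M : ℕ) (ε : ℝ), 0 < ε ∧ ∀ y : HilbertCube,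
      (∀ j < M, |(p j : ℝ) - y j| ≤ ε) → y ∈ U := by
  obtain ⟨V, hV, hVU⟩ := UniformSpace.mem_nhds_iff.1 (hU.mem_nhds hp)
  obtain ⟨M, ε, hε, h⟩ := exists_coordinates_of_mem_uniformity hV
  exact ⟨M, ε, hε, fun y hy => hVU (h p y hy)⟩

theorem isOpen_setOf_coordinates_lt (m : ℕ) (p : HilbertCube) (ε : ℝ) :
    IsOpen {x : HilbertCube | ∀ j < m, |(x j : ℝ) - p j| < ε} := by
  have : {x : HilbertCube | ∀ j < m, |(x j : ℝ) - p j| < ε} =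
      ⋂ j ∈ Finset.range m, {x : HilbertCube | |(x j : ℝ) - p j| < ε} := by
    ext x; simp
  rw [this]
  refine isOpen_biInter_finset fun j _ => isOpen_lt (by fun_prop) continuous_const

theorem exists_coordinates_bound {S : Set HilbertCube} (hS : IsCompact S)
    {f : HilbertCube → HilbertCube} (hf : Continuous f) {M : ℕ}
    (h : ∀ x ∈ S, ∀ j < M, 0 < (f x j : ℝ) ∧ (f x j : ℝ) < 1) :
    ∃ a > 0, a < 1 ∧ ∀ x ∈ S, ∀ j < M, a ≤ (f x j : ℝ) ∧ (f x j : ℝ) ≤ 1 - a := by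
  have h1 : ∀ j : Fin M, ∃ a > 0, ∀ x ∈ S, a ≤ min (f x j : ℝ) (1 - f x j) := by
    intro j
    refine hS.exists_forall_le' (by fun_prop) fun x hx => ?_
    have := h x hx j j.2
    exact lt_min this.1 (by linarith [this.2])
  choose a ha hab using h1
  have h2 : ∀ᶠ r in 𝓝[>] (0:ℝ), ∀ j, r < a j :=
    Filter.eventually_all.2 fun i => Filter.Eventually.filter_mono nhdsWithin_le_nhds
      (eventually_lt_nhds (ha i))
  have h3 : ∀ᶠ r in 𝓝[>] (0:ℝ), r < 1 := Filter.Eventually.filter_mono nhdsWithin_le_nhds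
      (eventually_lt_nhds zero_lt_one)
  obtain ⟨r, ⟨hr, hr1⟩, hr0⟩ := ((h2.and h3).and self_mem_nhdsWithin).exists
  refine ⟨r, hr0, hr1, fun x hx j hj => ?_⟩
  have h4 := (hr ⟨j, hj⟩).le.trans (hab ⟨j, hj⟩ x hx)
  exact ⟨h4.trans (min_le_left _ _), by linarith [h4.trans (min_le_right _ _)]⟩

/-- Every point can be moved into every non-empty open set by a homeomorphism. -/
theorem exists_homeomorph_mem_of_isOpen (x : HilbertCube) {U : Set HilbertCube} (hU : IsOpen U)
    (hne : U.Nonempty) : ∃ h : HilbertCube ≃ₜ HilbertCube, h x ∈ U := by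
  obtain ⟨p, hp⟩ := hne
  obtain ⟨M, ρ, hρ, hM⟩ := exists_coordinates_of_isOpen hU hp
  obtain ⟨κ, -, hκ⟩ := isPushable_singleton x 1 one_pos M
  obtain ⟨a, ha, ha1, hab⟩ := exists_coordinates_bound isCompact_singleton κ.continuous hκ
  choose θ _ hθ using fun j => exists_orderIso_squeeze (q := p j) ha ha1.le zero_le_one hρ
    (p j).2.1 (p j).2.2
  obtain ⟨h, -, hh⟩ := exists_skew_homeomorph ∅ (fun (_ : Unit) _ => 1)
    (fun _ => continuous_const) (fun _ _ => zero_le_one) (by simp) (by simp) (fun _ j => θ j)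
  refine ⟨κ.trans h, hM _ fun j hj => ?_⟩
  have h1 := hh (κ x) j (by simp)
  simp only [Finset.univ_unique, Finset.sum_singleton, one_mul] at h1
  rw [Homeomorph.trans_apply, h1, abs_sub_comm]
  have h2 := hab x rfl j hj
  refine hθ j _ h2.1 h2.2 ?_
  have := (κ x j).2.1; have := (κ x j).2.2; have := (p j).2.1; have := (p j).2.2
  rw [abs_le]; constructor <;> linarith

theorem exists_coordinates_separating {ι : Type*} [Finite ι] {C : ι → Set HilbertCube}
    (hC : ∀ k, IsClosed (C k)) (hdis : Pairwise fun k l => Disjoint (C k) (C l)) (m : ℕ) :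
    ∃ m₁ ≥ m, ∃ η > 0, ∀ k l, k ≠ l → ∀ x ∈ C k, ∀ y ∈ C l,
      ∃ j < m₁, η ≤ |(x j : ℝ) - y j| := by
  have h1 : ∀ s : {s : ι × ι // s.1 ≠ s.2}, ∃ V ∈ uniformity HilbertCube,
      Disjoint (⋃ x ∈ C s.1.1, UniformSpace.ball x V) (⋃ x ∈ C s.1.2, UniformSpace.ball x V) :=
    fun s => (hdis s.2).exists_uniform_thickening (hC _).isCompact (hC _)
  choose V hV hVd using h1
  obtain ⟨M, η, hη, hM⟩ := exists_coordinates_of_mem_uniformity (Filter.iInter_mem.2 hV)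
  refine ⟨max m M, le_max_left _ _, η, hη, fun k l hkl x hx y hy => ?_⟩
  by_contra! hcon
  have h2 : (x, y) ∈ V ⟨(k, l), hkl⟩ :=
    Set.mem_iInter.1 (hM x y fun j hj => (hcon j (lt_max_of_lt_right hj)).le) _
  refine Set.disjoint_left.1 (hVd ⟨(k, l), hkl⟩) (Set.mem_biUnion hx h2)
    (Set.mem_biUnion hy ?_)
  exact refl_mem_uniformity (hV _)

/-- Finitely many points can be approximated by points off a nowhere dense set which are pairwise
separated by a prescribed coordinate. -/
theorem exists_separated_notMem {ι : Type*} [Finite ι] (p : ι → HilbertCube)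
    {K : Set HilbertCube} (hK : Dense Kᶜ) {m m₁ : ℕ} (hm : m ≤ m₁) {ε : ℝ} (hε : 0 < ε) :
    ∃ q : ι → HilbertCube, (∀ k, q k ∉ K) ∧ (∀ k, ∀ j < m, |(p k j : ℝ) - q k j| ≤ ε) ∧
      ∃ τ > 0, ∀ k l, k ≠ l → τ ≤ |(q k m₁ : ℝ) - q l m₁| := by
  classical
  obtain ⟨r, ⟨e⟩⟩ := Finite.exists_equiv_fin ι
  have hr : (0:ℝ) < r + 1 := by positivity
  set τ : ℝ := 1 / (r + 1) with hτ
  have hτ0 : 0 < τ := by positivity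
  have hc : ∀ k, ((e k : ℕ) : ℝ) * τ ∈ Set.Icc (0:ℝ) 1 := by
    intro k
    refine ⟨by positivity, ?_⟩
    rw [hτ, mul_one_div, div_le_one hr]
    have : ((e k : ℕ) : ℝ) ≤ r := by exact_mod_cast (e k).2.le
    linarith
  let P : ι → HilbertCube := fun k => Function.update (p k) m₁ ⟨_, hc k⟩
  have h1 : ∀ k, ∃ q, q ∈ Kᶜ ∧ ∀ j < m₁ + 1, |(q j : ℝ) - P k j| < min ε (τ / 4) := by
    intro k
    obtain ⟨q, hq, hqK⟩ := hK.inter_open_nonempty _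
      (isOpen_setOf_coordinates_lt (m₁ + 1) (P k) (min ε (τ / 4)))
      ⟨P k, fun j _ => by simpa using ⟨hε, hτ0⟩⟩
    exact ⟨q, hqK, hq⟩
  choose q hqK hq using h1
  refine ⟨q, hqK, fun k j hj => ?_, τ / 2, by positivity, fun k l hkl => ?_⟩
  · have h2 := (hq k j (by omega)).le.trans (min_le_left _ _)
    have h3 : P k j = p k j := Function.update_of_ne (by omega) _ _
    rwa [h3, abs_sub_comm] at h2
  · have h2 : ∀ k, |(q k m₁ : ℝ) - (e k : ℕ) * τ| < τ / 4 := fun k => by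
      have := (hq k m₁ (by omega)).trans_le (min_le_right _ _)
      have h3 : P k m₁ = ⟨_, hc k⟩ := Function.update_self _ _ _
      rwa [h3] at this
    have h4 : τ ≤ |((e k : ℕ) : ℝ) * τ - (e l : ℕ) * τ| := by
      rw [← sub_mul, abs_mul, abs_of_pos hτ0]
      refine le_mul_of_one_le_left hτ0.le ?_
      have h5 : ((e k : ℕ) : ℤ) - (e l : ℕ) ≠ 0 := by
        intro h
        exact hkl (e.injective (Fin.ext (by omega)))
      exact_mod_cast Int.one_le_abs h5
    have h5 := abs_lt.1 (h2 k)
    have h6 := abs_lt.1 (h2 l)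
    rcases le_abs.1 h4 with h | h
    · exact le_abs.2 (Or.inl (by linarith))
    · exact le_abs.2 (Or.inr (by linarith))

theorem exists_coordinates_notMem {ι : Type*} [Finite ι] {q : ι → HilbertCube}
    {K : Set HilbertCube} (hK : IsClosed K) (hq : ∀ k, q k ∉ K) :
    ∃ (M : ℕ) (ρ : ℝ), 0 < ρ ∧ ∀ k, ∀ y : HilbertCube,
      (∀ j < M, |(q k j : ℝ) - y j| ≤ ρ) → y ∉ K := by
  have h1 : ∀ k, ∃ V ∈ uniformity HilbertCube, UniformSpace.ball (q k) V ⊆ Kᶜ := fun k =>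
    UniformSpace.mem_nhds_iff.1 (hK.isOpen_compl.mem_nhds (hq k))
  choose V hV hVK using h1
  obtain ⟨M, ρ, hρ, hM⟩ := exists_coordinates_of_mem_uniformity (Filter.iInter_mem.2 hV)
  exact ⟨M, ρ, hρ, fun k y hy => hVK k (Set.mem_iInter.1 (hM _ _ hy) k)⟩

/-- A finite disjoint family of small closed sets can be pushed off a closed nowhere dense set by
a homeomorphism close to the identity. -/
theorem exists_homeomorph_disjoint_family_avoiding {ι : Type*} [Finite ι]
    {C : ι → Set HilbertCube} (hC : ∀ k, IsClosed (C k))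
    (hdis : Pairwise fun k l => Disjoint (C k) (C l)) (hpush : IsPushable (⋃ k, C k))
    {m : ℕ} {ε : ℝ} (hε : 0 < ε)
    (hosc : ∀ k, ∀ x ∈ C k, ∀ y ∈ C k, ∀ j < m, |(x j : ℝ) - y j| ≤ ε / 4)
    {K : Set HilbertCube} (hKc : IsClosed K) (hKd : Dense Kᶜ) :
    ∃ g : HilbertCube ≃ₜ HilbertCube, (∀ x, ∀ j < m, |(g x j : ℝ) - x j| ≤ ε) ∧
      ∀ k, ∀ x ∈ C k, g x ∉ K := by
  classical
  rcases isEmpty_or_nonempty ι with hι | hι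
  · exact ⟨Homeomorph.refl _, fun x j _ => by simpa using hε.le, fun k => (hι.false k).elim⟩
  have : Fintype ι := Fintype.ofFinite ι
  have hp : ∀ k, ∃ p : HilbertCube, ∀ x ∈ C k, ∀ j < m, |(x j : ℝ) - p j| ≤ ε / 4 := by
    intro k
    rcases (C k).eq_empty_or_nonempty with h | ⟨p, hp⟩
    · exact ⟨fun _ => 0, by simp [h]⟩
    · exact ⟨p, fun x hx => hosc k x hx p hp⟩
  choose p hp using hp
  obtain ⟨m₁, hm₁, η, hη, hsep⟩ := exists_coordinates_separating hC hdis m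
  obtain ⟨q, hqK, hqp, τ, hτ, hqτ⟩ :=
    exists_separated_notMem p hKd (show m ≤ m₁ from hm₁) (by positivity : 0 < ε / 4)
  obtain ⟨M, ρ₀, hρ₀, hM⟩ := exists_coordinates_notMem hKc hqK
  obtain ⟨ρ, hρ, hρ₁, hρτ⟩ : ∃ ρ > 0, ρ ≤ ρ₀ ∧ ρ ≤ τ / 4 :=
    ⟨min ρ₀ (τ / 4), by positivity, min_le_left _ _, min_le_right _ _⟩
  obtain ⟨δ, hδ, hδε, hδη⟩ : ∃ δ > 0, δ ≤ ε / 4 ∧ δ ≤ η / 4 :=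
    ⟨min (ε / 4) (η / 4), by positivity, min_le_left _ _, min_le_right _ _⟩
  obtain ⟨κ, hκ, hκC⟩ := hpush δ hδ (max M (m₁ + 1))
  have hκm : ∀ x, ∀ j ≤ m₁, |(κ x j : ℝ) - x j| ≤ δ := fun x j hj => hκ x j (by
    have := le_max_right M (m₁ + 1); omega)
  obtain ⟨a, ha, ha1, hab⟩ := exists_coordinates_bound
    (isCompact_iUnion fun k => (hC k).isCompact) κ.continuous hκC
  let R : HilbertCube → Fin m₁ → ↥(Set.Icc (0:ℝ) 1) := fun x i => x i
  have hR : Continuous R := continuous_pi fun i => continuous_apply (i : ℕ)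
  obtain ⟨w, hwc, hw0, hw1, hwD⟩ := exists_weights (fun k => (R ∘ κ) '' C k)
    (fun k => ((hC k).isCompact.image (hR.comp κ.continuous)).isClosed) (by
      intro k l hkl
      refine Set.disjoint_left.2 ?_
      rintro _ ⟨x, hx, rfl⟩ ⟨y, hy, hxy⟩
      obtain ⟨j, hj, hηj⟩ := hsep k l hkl x hx y hy
      have h1 : κ y j = κ x j := congrFun hxy ⟨j, hj⟩
      have h2 := abs_le.1 (hκm x j hj.le)
      have h3 := abs_le.1 (hκm y j hj.le)
      rw [h1] at h3
      rcases le_abs.1 hηj with h | h <;> linarith)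
  choose θ _ hθ using fun k => exists_orderIso_squeeze (q := q k m₁) ha ha1.le zero_le_one hρ
    (q k m₁).2.1 (q k m₁).2.2
  obtain ⟨ψ, hψ, hψm⟩ := exists_skew_homeomorph {m₁}ᶜ (fun k x => w k (R x))
    (fun k => (hwc k).comp hR) (fun k x => hw0 k _) (fun x => hw1 _)
    (fun k x y hxy => congrArg (w k) (funext fun i => hxy i (by
      simp only [Set.mem_compl_iff, Set.mem_singleton_iff]
      exact i.2.ne)))
    (fun k _ => θ k)
  obtain ⟨u, huc, hu0, hu1, huD⟩ := exists_weights (fun k => Metric.closedBall (q k m₁) ρ)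
    (fun k => Metric.isClosed_closedBall) (by
      intro k l hkl
      refine Metric.closedBall_disjoint_closedBall ?_
      have := hqτ k l hkl
      rw [Subtype.dist_eq, Real.dist_eq]
      linarith)
  choose Θ hΘ₁ hΘ₂ using fun (k : ι) (i : ℕ) => exists_orderIso_squeeze (q := q k i)
    (ε := if i < m then 3 * ε / 4 else 1) ha ha1.le (by split_ifs <;> positivity) hρ
    (q k i).2.1 (q k i).2.2
  obtain ⟨φ, hφm, hφ⟩ := exists_skew_homeomorph {m₁} (fun k x => u k (x m₁))
    (fun k => (huc k).comp (continuous_apply m₁)) (fun k x => hu0 k _) (fun x => hu1 _)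
    (fun k x y hxy => congrArg (u k) (hxy m₁ rfl)) Θ
  refine ⟨(κ.trans ψ).trans φ, fun x j hj => ?_, fun k x hx => hM k _ fun j hj => ?_⟩
  · have hjm : j ≠ m₁ := by omega
    have h1 : ψ (κ x) j = κ x j := hψ _ _ hjm
    have h2 : |(φ (ψ (κ x)) j : ℝ) - ψ (κ x) j| ≤ 3 * ε / 4 := by
      rw [hφ _ j hjm]
      refine abs_sum_mul_sub_le (fun k => hu0 k _) (hu1 _) fun k => ?_
      simpa [hj] using hΘ₁ k j (ψ (κ x) j)
    have h3 := abs_le.1 (hκm x j (by omega))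
    rw [h1] at h2
    have h4 := abs_le.1 h2
    simp only [Homeomorph.trans_apply]
    rw [abs_le]; constructor <;> linarith
  · have hxa := hab x (Set.mem_iUnion.2 ⟨k, hx⟩)
    have hd : ∀ s t : ↥(Set.Icc (0:ℝ) 1), |(s:ℝ) - t| ≤ 1 := fun s t => by
      have := s.2.1; have := s.2.2; have := t.2.1; have := t.2.2
      rw [abs_le]; constructor <;> linarith
    have h1 : |(ψ (κ x) m₁ : ℝ) - q k m₁| ≤ ρ := by
      have hwk : w k (R (κ x)) = 1 := hwD k _ ⟨x, hx, rfl⟩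
      rw [hψm _ m₁ (by simp), sum_mul_eq_of_weight_eq_one (fun k => hw0 k _) (hw1 _) hwk]
      have h2 := hxa m₁ (lt_max_of_lt_right (by omega))
      exact hθ k _ h2.1 h2.2 (hd _ _)
    refine le_trans ?_ hρ₁
    simp only [Homeomorph.trans_apply]
    rw [abs_sub_comm]
    by_cases hjm : j = m₁
    · subst hjm
      rwa [hφm _ _ rfl]
    · have h3 : ψ (κ x) j = κ x j := hψ _ _ hjm
      rw [hφ _ j hjm, sum_mul_eq_of_weight_eq_one (fun k => hu0 k _) (hu1 _)
        (huD k _ (by rwa [Metric.mem_closedBall, Subtype.dist_eq, Real.dist_eq])), h3]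
      have h2 := hxa j (lt_max_of_lt_left hj)
      refine hΘ₂ k j _ h2.1 h2.2 ?_
      split_ifs with hj'
      · have h4 := abs_le.1 (hκm x j (by omega))
        have h5 := abs_le.1 (hp k x hx j hj')
        have h6 := abs_le.1 (hqp k j hj')
        rw [abs_le]; constructor <;> linarith
      · exact hd _ _

/-- Ostrand's decomposition: in dimension at most `n` every finite open cover is refined by a closed
cover which is a union of `n + 1` finite disjoint families. -/
theorem CovDimLE.exists_closed_decomposition {Y : Type*} [TopologicalSpace Y] [NormalSpace Y]
    [ParacompactSpace Y] {n : ℕ} (hY : CovDimLE Y n) {U : Set (Set Y)} (hUf : U.Finite)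
    (hUo : ∀ W ∈ U, IsOpen W) (hUc : ⋃₀ U = Set.univ) :
    ∃ (V : Set (Set Y)) (_ : Finite V) (C : Fin (n + 1) → Finset V → Set Y),
      (∀ j k, IsClosed (C j k)) ∧ (∀ j, Pairwise fun k l => Disjoint (C j k) (C j l)) ∧
      (∀ j k, ∀ x ∈ C j k, ∃ W ∈ U, C j k ⊆ W) ∧ ∀ x, ∃ j k, x ∈ C j k := by
  classical
  obtain ⟨V, hVf, hVo, hVc, hVU, hVn⟩ := hY U hUf hUo hUc
  have hVfin : Finite V := hVf
  have : Fintype V := Fintype.ofFinite V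
  obtain ⟨f, hf⟩ := PartitionOfUnity.exists_isSubordinate isClosed_univ
    (fun v : V => (v : Set Y)) (fun v => hVo v v.2) (by rw [← Set.sUnion_eq_iUnion, hVc])
  have hmem : ∀ v x, 0 < f v x → x ∈ (v : Set Y) := fun v x h =>
    hf v (subset_tsupport _ h.ne')
  let σs := {σ : Finset V // 0 < σ.card ∧ σ.card ≤ n + 1}
  let G : σs → Set Y := fun σ => {x | ∀ v ∈ σ.1, 0 < f v x ∧ ∀ w, w ∉ σ.1 → f w x < f v x}
  have hGo : ∀ σ, IsOpen (G σ) := by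
    intro σ
    have : G σ = ⋂ v ∈ σ.1, ({x | 0 < f v x} ∩ ⋂ w, ⋂ (_ : w ∉ σ.1), {x | f w x < f v x}) := by
      ext x
      simp [G]
    rw [this]
    refine isOpen_biInter_finset fun v _ => (isOpen_lt continuous_const (f v).continuous).inter ?_
    exact isOpen_iInter_of_finite fun w => isOpen_iInter_of_finite fun _ =>
      isOpen_lt (f w).continuous (f v).continuous
  have hGc : ⋃ σ, G σ = Set.univ := by
    refine Set.eq_univ_of_forall fun x => Set.mem_iUnion.2 ?_
    have hsum : ∑ v, f v x = 1 := by
      rw [← finsum_eq_sum_of_fintype]; exact f.sum_eq_one (Set.mem_univ x)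
    obtain ⟨v₁, hv₁⟩ : ∃ v, 0 < f v x := by
      by_contra! h
      have := Finset.sum_nonpos fun v (_ : v ∈ Finset.univ) => h v
      linarith
    obtain ⟨v₀, -, hv₀⟩ := Finset.exists_max_image Finset.univ (fun v => f v x)
      ⟨v₁, Finset.mem_univ v₁⟩
    have hpos : 0 < f v₀ x := hv₁.trans_le (hv₀ v₁ (Finset.mem_univ _))
    let σ : Finset V := Finset.univ.filter fun v => f v x = f v₀ x
    have hσ : ∀ v, v ∈ σ ↔ f v x = f v₀ x := fun v => by simp [σ]
    have hcard : σ.card ≤ n + 1 := by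
      refine le_trans ?_ (hVn x)
      rw [← Finset.card_map (Function.Embedding.subtype _), ← Set.ncard_coe_finset]
      refine Set.ncard_le_ncard ?_ (hVf.subset fun _ h => h.1)
      intro W hW
      simp only [Finset.coe_map, Set.mem_image, Finset.mem_coe] at hW
      obtain ⟨v, hv, rfl⟩ := hW
      exact ⟨v.2, hmem v x ((hσ v).1 hv ▸ hpos)⟩
    refine ⟨⟨σ, Finset.card_pos.2 ⟨v₀, (hσ v₀).2 rfl⟩, hcard⟩, fun v hv => ?_⟩
    rw [(hσ v).1 hv]
    refine ⟨hpos, fun w hw => lt_of_le_of_ne (hv₀ w (Finset.mem_univ _)) fun h => hw ((hσ w).2 h)⟩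
  obtain ⟨D, hDc, hDcl, hDG⟩ := exists_iUnion_eq_closed_subset hGo (fun x => Set.toFinite _) hGc
  refine ⟨V, hVfin, fun j σ => {x | ∃ h : 0 < σ.card ∧ σ.card ≤ n + 1,
    σ.card = j + 1 ∧ x ∈ D ⟨σ, h⟩}, fun j σ => ?_, fun j σ τ hστ => ?_, fun j σ x hx => ?_,
    fun x => ?_⟩
  · by_cases h : (0 < σ.card ∧ σ.card ≤ n + 1) ∧ σ.card = j + 1
    · convert hDcl ⟨σ, h.1⟩ using 1
      ext x
      exact ⟨fun ⟨_, _, hx⟩ => hx, fun hx => ⟨h.1, h.2, hx⟩⟩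
    · convert isClosed_empty using 1
      exact Set.eq_empty_of_forall_notMem fun x ⟨h1, h2, _⟩ => h ⟨h1, h2⟩
  · refine Set.disjoint_left.2 ?_
    rintro x ⟨h1, h2, h3⟩ ⟨h4, h5, h6⟩
    have h7 := hDG _ h3
    have h8 := hDG _ h6
    obtain ⟨v, hv, hv'⟩ : ∃ v ∈ σ, v ∉ τ := by
      by_contra! h
      exact hστ (Finset.eq_of_subset_of_card_le h (h5.trans h2.symm).le)
    obtain ⟨w, hw, hw'⟩ : ∃ w ∈ τ, w ∉ σ := by
      by_contra! h
      exact hστ (Finset.eq_of_subset_of_card_le h (h2.trans h5.symm).le).symm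
    exact lt_asymm ((h7 v hv).2 w hw') ((h8 w hw).2 v hv')
  · obtain ⟨h1, h2, h3⟩ := hx
    obtain ⟨v, hv⟩ := Finset.card_pos.1 h1.1
    obtain ⟨W, hW, hvW⟩ := hVU v v.2
    refine ⟨W, hW, ?_⟩
    rintro y ⟨_, _, hy⟩
    exact hvW (hmem v y (hDG _ hy v hv).1)
  · obtain ⟨σ, hσ⟩ := Set.mem_iUnion.1 (hDc.symm ▸ Set.mem_univ x : x ∈ ⋃ σ, D σ)
    exact ⟨⟨σ.1.card - 1, by have := σ.2; omega⟩, σ.1, σ.2,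
      by have := σ.2; simp only; omega, hσ⟩

theorem exists_closed_decomposition_of_covDimLE {F : Set HilbertCube} (hF : IsClosed F) {n : ℕ}
    (hn : CovDimLE F n) (m : ℕ) {ε : ℝ} (hε : 0 < ε) :
    ∃ (ι : Type) (_ : Finite ι) (C : Fin (n + 1) → ι → Set HilbertCube),
      (∀ j k, IsClosed (C j k)) ∧ (∀ j, Pairwise fun k l => Disjoint (C j k) (C j l)) ∧
      (∀ j k, ∀ x ∈ C j k, ∀ y ∈ C j k, ∀ i < m, |(x i : ℝ) - y i| ≤ ε) ∧
      ∀ x ∈ F, ∃ j k, x ∈ C j k := by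
  classical
  have : CompactSpace F := isCompact_iff_compactSpace.1 hF.isCompact
  let B : F → Set F := fun p => {x | ∀ i < m, |((x : HilbertCube) i : ℝ) - p.1 i| < ε / 2}
  have hB : ∀ p, IsOpen (B p) := fun p =>
    (isOpen_setOf_coordinates_lt m p.1 (ε / 2)).preimage continuous_subtype_val
  obtain ⟨t, ht⟩ := isCompact_univ.elim_finite_subcover B hB fun p _ =>
    Set.mem_iUnion.2 ⟨p, fun i _ => by simpa using hε⟩
  obtain ⟨V, hV, C, hCc, hCd, hCs, hC⟩ := hn.exists_closed_decomposition
    (U := B '' (t : Set F)) (t.finite_toSet.image B) (by rintro _ ⟨p, _, rfl⟩; exact hB p)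
    (Set.eq_univ_of_forall fun x => by
      obtain ⟨p, hp, hx⟩ := Set.mem_iUnion₂.1 (ht (Set.mem_univ x))
      exact ⟨B p, ⟨p, hp, rfl⟩, hx⟩)
  refine ⟨Finset V, inferInstance, fun j k => Subtype.val '' C j k,
    fun j k => hF.isClosedEmbedding_subtypeVal.isClosedMap _ (hCc j k),
    fun j k l hkl => (Set.disjoint_image_iff Subtype.val_injective).2 (hCd j hkl), ?_, ?_⟩
  · rintro j k _ ⟨x, hx, rfl⟩ _ ⟨y, hy, rfl⟩ i hi
    obtain ⟨_, ⟨p, _, rfl⟩, hp⟩ := hCs j k x hx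
    have h1 := abs_lt.1 (hp hx i hi)
    have h2 := abs_lt.1 (hp hy i hi)
    rw [abs_le]; constructor <;> linarith
  · intro x hx
    obtain ⟨j, k, h⟩ := hC ⟨x, hx⟩
    exact ⟨j, k, ⟨x, hx⟩, h, rfl⟩

theorem exists_homeomorph_tuple_near_refl {F : Set HilbertCube} (hF : IsClosed F) {n : ℕ}
    (hn : CovDimLE F n) {A : Set HilbertCube} (hA : IsClosed A) (hAF : A ⊆ F)
    (hAp : IsPushable A) {K : Fin (n + 1) → Set HilbertCube} (hKc : ∀ j, IsClosed (K j))
    (hKd : ∀ j, Dense (K j)ᶜ) {V : Set (HilbertCube × HilbertCube)}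
    (hV : V ∈ uniformity HilbertCube) :
    ∃ g : Fin (n + 1) → HilbertCube ≃ₜ HilbertCube, (∀ j x, (g j x, x) ∈ V) ∧
      ∀ x ∈ A, ∃ j, g j x ∉ K j := by
  obtain ⟨m, ε, hε, hm⟩ := exists_coordinates_of_mem_uniformity hV
  obtain ⟨ι, _, C, hCc, hCd, hCs, hC⟩ :=
    exists_closed_decomposition_of_covDimLE hF hn m (by positivity : 0 < ε / 4)
  choose g hg hgK using fun j => exists_homeomorph_disjoint_family_avoiding
    (C := fun k => C j k ∩ A) (fun k => (hCc j k).inter hA)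
    (fun k l hkl => (hCd j hkl).mono Set.inter_subset_left Set.inter_subset_left)
    (hAp.mono (Set.iUnion_subset fun k => Set.inter_subset_right)) hε
    (fun k x hx y hy => hCs j k x hx.1 y hy.1) (hKc j) (hKd j)
  refine ⟨g, fun j x => hm _ _ (hg j x), fun x hx => ?_⟩
  obtain ⟨j, k, hjk⟩ := hC x (hAF hx)
  exact ⟨j, hgK j k x ⟨hjk, hx⟩⟩

/-- A countable family of pushable closed subsets of an `n`-dimensional closed set can be moved off
a countable union of closed nowhere dense sets by `n + 1` homeomorphisms. -/
theorem exists_homeomorph_tuple_forall_notMem {F : Set HilbertCube} (hF : IsClosed F) {n : ℕ}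
    (hn : CovDimLE F n) {α : Type*} [Countable α] {A : α → Set HilbertCube}
    (hA : ∀ l, IsClosed (A l)) (hAF : ∀ l, A l ⊆ F) (hAp : ∀ l, IsPushable (A l))
    {K : ℕ → Set HilbertCube} (hKc : ∀ i, IsClosed (K i)) (hKd : ∀ i, Dense (K i)ᶜ) :
    ∃ h : Fin (n + 1) → HilbertCube ≃ₜ HilbertCube,
      ∀ l, ∀ x ∈ A l, ∃ j, ∀ i, h j x ∉ K i := by
  obtain ⟨h, hh⟩ := exists_homeomorph_tuple_avoiding
    (fun a : α × (Fin (n + 1) → ℕ) => A a.1) (fun a (j : Fin (n + 1)) => K (a.2 j))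
    (fun a => (hA a.1).isCompact) (fun a j => hKc _) (fun a V hV h =>
      exists_homeomorph_tuple_near_refl hF hn (hA a.1) (hAF a.1) (hAp a.1)
        (K := fun j => h j ⁻¹' K (a.2 j)) (fun j => (hKc _).preimage (h j).continuous)
        (fun j => (hKd (a.2 j)).preimage (h j).isOpenMap) hV)
  refine ⟨h, fun l x hx => ?_⟩
  by_contra! hcon
  choose i hi using hcon
  obtain ⟨j, hj⟩ := hh (l, i) x hx
  exact hj (hi j)

theorem IsIdeal.iUnion_mem {X ι : Type*} [Finite ι] {I : Set (Set X)} (hI : IsIdeal I)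
    {A : ι → Set X} (hA : ∀ k, A k ∈ I) : ⋃ k, A k ∈ I := by
  have h0 : ∅ ∈ I := hI.1.elim fun A hA => hI.2.1 A hA ∅ (Set.empty_subset A)
  have h1 : ∀ s : Set ι, s.Finite → ⋃ k ∈ s, A k ∈ I := fun s hs => by
    induction s, hs using Set.Finite.induction_on with
    | empty => simpa using h0
    | insert _ _ ih => rw [Set.biUnion_insert]; exact hI.2.2 _ (hA _) _ ih
  simpa using h1 Set.univ Set.finite_univ

theorem TopInvariant.preimage_mem {X : Type*} [TopologicalSpace X] {I : Set (Set X)}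
    (hI : TopInvariant I) (h : X ≃ₜ X) {A : Set X} (hA : A ∈ I) : h ⁻¹' A ∈ I := by
  rw [← hI h.symm]
  exact ⟨A, hA, (h.image_symm ▸ rfl : h ⁻¹' A = h.symm '' A)⟩

theorem IsMeagre.exists_nat_cover {X : Type*} [TopologicalSpace X] {A : Set X} (hA : IsMeagre A) :
    ∃ K : ℕ → Set X, (∀ i, IsClosed (K i)) ∧ (∀ i, Dense (K i)ᶜ) ∧ A ⊆ ⋃ i, K i := by
  obtain ⟨S, hS, hSc, hAS⟩ := isMeagre_iff_countable_union_isNowhereDense.1 hA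
  obtain ⟨f, hf⟩ := (hSc.insert ∅).exists_eq_range (Set.insert_nonempty _ _)
  refine ⟨fun i => closure (f i), fun i => isClosed_closure, fun i => ?_, fun x hx => ?_⟩
  · rw [← interior_eq_empty_iff_dense_compl]
    rcases (hf ▸ Set.mem_range_self i : f i ∈ insert ∅ S) with h | h
    · simp [h]
    · exact hS _ h
  · obtain ⟨t, ht, hxt⟩ := hAS hx
    obtain ⟨i, rfl⟩ : t ∈ Set.range f := hf ▸ Set.mem_insert_of_mem _ ht
    exact Set.mem_iUnion.2 ⟨i, subset_closure hxt⟩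

/-- A topologically invariant ideal with BP-base which contains a non-meager set contains a
comeager set. -/
theorem exists_mem_isMeagre_compl {I : Set (Set HilbertCube)} (hI : IsIdeal I)
    (hinv : TopInvariant I) (hbp : HasBaseWith I HasBaireProperty)
    (hnm : ¬ I ⊆ MeagerIdeal HilbertCube) : ∃ G ∈ I, IsMeagre Gᶜ := by
  obtain ⟨A, hA, hAm⟩ := Set.not_subset.1 hnm
  obtain ⟨𝓑, h𝓑, hbase, hBP⟩ := hbp
  obtain ⟨B, hB, hAB⟩ := hbase A hA
  obtain ⟨U, hU, hUB⟩ := hBP B hB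
  have hne : U.Nonempty := by
    by_contra h
    rw [Set.not_nonempty_iff_eq_empty] at h
    refine hAm (hUB.mono fun x hx => Or.inl ⟨hAB hx, ?_⟩)
    simp [h]
  choose h hh using fun x => exists_homeomorph_mem_of_isOpen x hU hne
  obtain ⟨t, ht⟩ := isCompact_univ.elim_finite_subcover (fun x => h x ⁻¹' U)
    (fun x => hU.preimage (h x).continuous) fun x _ => Set.mem_iUnion.2 ⟨x, hh x⟩
  refine ⟨⋃ x : t, h x ⁻¹' B, hI.iUnion_mem fun x => hinv.preimage_mem _ (h𝓑 hB), ?_⟩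
  have h1 : IsMeagre (⋃ x : t, h x ⁻¹' (U \ B)) := isMeagre_iUnion fun x =>
    (hUB.mono Set.subset_union_right).preimage_of_isOpenMap (h x).continuous (h x).isOpenMap
  refine h1.mono fun y hy => ?_
  obtain ⟨x, hx, hyx⟩ := Set.mem_iUnion₂.1 (ht (Set.mem_univ y))
  exact Set.mem_iUnion.2 ⟨⟨x, hx⟩, hyx, fun hyB => hy (Set.mem_iUnion.2 ⟨⟨x, hx⟩, hyB⟩)⟩

/-- Every closed finite-dimensional subset of the Hilbert cube belongs to every
topologically invariant ideal with BP-base not contained in the meager ideal. -/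
theorem closed_finite_dimensional_in_nonmeager_ideal (I : Set (Set HilbertCube))
    (hI : IsIdeal I) (hinv : TopInvariant I)
    (hbp : HasBaseWith I HasBaireProperty)
    (hnm : ¬ I ⊆ MeagerIdeal HilbertCube) :
    ∀ F : Set HilbertCube, IsClosed F → (∃ n : ℕ, CovDimLE ↥F n) → F ∈ I := by
  rintro F hF ⟨n, hn⟩
  obtain ⟨G, hG, hGm⟩ := exists_mem_isMeagre_compl hI hinv hbp hnm
  obtain ⟨K, hKc, hKd, hGK⟩ := hGm.exists_nat_cover
  have hmem : ∀ x, (∀ i, x ∉ K i) → x ∈ G := fun x hx => by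
    by_contra h
    obtain ⟨i, hi⟩ := Set.mem_iUnion.1 (hGK h)
    exact hx i hi
  obtain ⟨h, hh⟩ := exists_homeomorph_tuple_forall_notMem hF hn
    (A := fun a : ℕ × Bool => F ∩ {x | 2 * (x a.1 : ℝ) - 1 = if a.2 then 1 else -1})
    (fun a => hF.inter (isClosed_eq (by fun_prop) continuous_const))
    (fun a => Set.inter_subset_left)
    (fun a => (isPushable_face a.1 (by split_ifs <;> simp)).mono Set.inter_subset_right) hKc hKd
  have hint : ∀ x ∈ F, (∀ j, ∃ i, h j x ∈ K i) → ∀ i, 0 < (x i : ℝ) ∧ (x i : ℝ) < 1 := by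
    intro x hx hcov i
    have hface : ∀ b : Bool, 2 * (x i : ℝ) - 1 ≠ if b then 1 else -1 := fun b hb => by
      obtain ⟨j, hj⟩ := hh (i, b) x ⟨hx, hb⟩
      exact (hcov j).elim hj
    refine ⟨(x i).2.1.lt_of_ne fun h0 => hface false ?_, (x i).2.2.lt_of_ne fun h1 => hface true ?_⟩
    · simp [← h0]
    · norm_num [h1]
  obtain ⟨g, hg⟩ := exists_homeomorph_tuple_forall_notMem hF hn
    (A := fun a : Fin (n + 1) → ℕ => F ∩ ⋂ j, h j ⁻¹' K (a j))
    (fun a => hF.inter (isClosed_iInter fun j => (hKc _).preimage (h j).continuous))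
    (fun a => Set.inter_subset_left)
    (fun a => isPushable_of_interior fun x hx =>
      hint x hx.1 fun j => ⟨a j, Set.mem_iInter.1 hx.2 j⟩) hKc hKd
  refine hI.2.1 _ (hI.2.2 _ (hI.iUnion_mem fun j => hinv.preimage_mem (h j) hG)
    _ (hI.iUnion_mem fun j => hinv.preimage_mem (g j) hG)) F fun x hx => ?_
  by_cases hcov : ∀ j, ∃ i, h j x ∈ K i
  · choose a ha using hcov
    obtain ⟨j, hj⟩ := hg a x ⟨hx, Set.mem_iInter.2 ha⟩
    exact Or.inr (Set.mem_iUnion.2 ⟨j, hmem _ hj⟩)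
  · push Not at hcov
    obtain ⟨j, hj⟩ := hcov
    exact Or.inl (Set.mem_iUnion.2 ⟨j, hmem _ hj⟩)
end

section
/- cov(σC₀) = cov(M), where σC₀ is the σ-ideal generated by minimal Cantor sets in the Hilbert cube I^ω and M is the σ-ideal of meager subsets of I^ω. -/
open Set Topology Cardinal

/-! ### The logistic action of the additive reals on the unit interval -/

lemma logistic_denom_pos (r : ℝ) (x : unitInterval) :
    0 < 1 - (x : ℝ) + Real.exp r * x := by
  have h0 := x.2.1
  have h1 := x.2.2
  have he := Real.exp_pos r
  rcases h0.eq_or_lt with h | h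
  · rw [← h]; norm_num
  · have := mul_pos he h; linarith

/-- The logistic flow on the unit interval. -/
noncomputable def logisticFlow (r : ℝ) (x : unitInterval) : unitInterval :=
  ⟨Real.exp r * x / (1 - x + Real.exp r * x), by
    have hd := logistic_denom_pos r x
    have h0 := mul_nonneg (Real.exp_pos r).le x.2.1
    refine ⟨div_nonneg h0 hd.le, (div_le_one hd).2 ?_⟩
    linarith [x.2.2]⟩

lemma coe_logisticFlow (r : ℝ) (x : unitInterval) :
    (logisticFlow r x : ℝ) = Real.exp r * x / (1 - x + Real.exp r * x) := rfl

lemma logisticFlow_zero (x : unitInterval) : logisticFlow 0 x = x := by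
  ext; simp [coe_logisticFlow]

lemma logisticFlow_add (r s : ℝ) (x : unitInterval) :
    logisticFlow r (logisticFlow s x) = logisticFlow (r + s) x := by
  ext
  have h1 := (logistic_denom_pos s x).ne'
  have h2 := (logistic_denom_pos (r + s) x).ne'
  have h3 := (logistic_denom_pos r (logisticFlow s x)).ne'
  rw [coe_logisticFlow] at h3
  rw [coe_logisticFlow, coe_logisticFlow, coe_logisticFlow]
  rw [div_eq_div_iff h3 h2, Real.exp_add]
  field_simp
  ring

lemma continuous_logisticFlow : Continuous fun p : ℝ × unitInterval => logisticFlow p.1 p.2 := by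
  refine Continuous.subtype_mk ?_ _
  refine Continuous.div (by fun_prop) (by fun_prop) ?_
  intro p
  exact (logistic_denom_pos p.1 p.2).ne'

/-- The logit function. -/
noncomputable def logit (x : unitInterval) : ℝ := Real.log ((x : ℝ) / (1 - x))

lemma logisticFlow_logit_sub {x y : unitInterval} (hx : (x : ℝ) ∈ Ioo (0 : ℝ) 1)
    (hy : (y : ℝ) ∈ Ioo (0 : ℝ) 1) : logisticFlow (logit y - logit x) x = y := by
  ext
  have hx1 : (0 : ℝ) < 1 - x := by linarith [hx.2]
  have hy1 : (0 : ℝ) < 1 - y := by linarith [hy.2]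
  have hx0 : (0 : ℝ) < x := hx.1
  have hy0 : (0 : ℝ) < y := hy.1
  have he : Real.exp (logit y - logit x) = (y / (1 - y)) / (x / (1 - x)) := by
    rw [Real.exp_sub, logit, logit, Real.exp_log (div_pos hy0 hy1), Real.exp_log (div_pos hx0 hx1)]
  rw [coe_logisticFlow, he]
  have : (1 : ℝ) - x + (y / (1 - y)) / (x / (1 - x)) * x = (1 - x) / (1 - y) := by
    field_simp; ring
  rw [this]
  field_simp

lemma half_lt_logisticFlow_iff (r : ℝ) (x : unitInterval) :
    1 / 2 < (logisticFlow r x : ℝ) ↔ 1 - (x : ℝ) < Real.exp r * x := by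
  rw [coe_logisticFlow, lt_div_iff₀ (logistic_denom_pos r x)]
  constructor <;> intro h <;> linarith

lemma logisticFlow_mem_Ioo (r : ℝ) {x : unitInterval} (hx : (x : ℝ) ∈ Ioo (0 : ℝ) 1) :
    (logisticFlow r x : ℝ) ∈ Ioo (0 : ℝ) 1 := by
  have hd := logistic_denom_pos r x
  have := mul_pos (Real.exp_pos r) hx.1
  rw [coe_logisticFlow]
  refine ⟨div_pos this hd, (div_lt_one hd).2 ?_⟩
  linarith [hx.2]

lemma continuous_logit_comp {X : Type*} [TopologicalSpace X] {f : X → unitInterval}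
    (hf : Continuous f) (hi : ∀ x, (f x : ℝ) ∈ Ioo (0 : ℝ) 1) :
    Continuous fun x => logit (f x) := by
  unfold logit
  refine Continuous.log (Continuous.div (by fun_prop) (by fun_prop) ?_) ?_
  · intro x; linarith [(hi x).2]
  · intro x
    exact (div_pos (hi x).1 (by linarith [(hi x).2])).ne'

/-- A compact family of coordinatewise logistic shears extends to a homeomorphism. -/
theorem exists_shear {X : Type*} [TopologicalSpace X] [CompactSpace X]
    {u : X → HilbertCube} (hu : Continuous u) (hinj : Function.Injective u)
    {g : X → ℕ → ℝ} (hg : Continuous g) :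
    ∃ h : HilbertCube × HilbertCube ≃ₜ HilbertCube × HilbertCube,
      ∀ x v, h (u x, v) = (u x, fun n => logisticFlow (g x n) (v n)) := by
  have he : IsClosedEmbedding u := hu.isClosedEmbedding hinj
  have hG : ∀ n, ∃ G : C(HilbertCube, ℝ), ∀ x, G (u x) = g x n := by
    intro n
    obtain ⟨G, hG⟩ := ContinuousMap.exists_extension he
      (⟨fun x => g x n, by fun_prop⟩ : C(X, ℝ))
    exact ⟨G, fun x => DFunLike.congr_fun hG x⟩
  choose G hG using hG
  have hc : ∀ s : ℝ, Continuous fun p : HilbertCube × HilbertCube =>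
      (p.1, fun n => logisticFlow (s * G n p.1) (p.2 n)) := by
    intro s
    refine continuous_fst.prodMk (continuous_pi fun n => ?_)
    exact continuous_logisticFlow.comp (by fun_prop :
      Continuous fun p : HilbertCube × HilbertCube => (s * G n p.1, p.2 n))
  refine ⟨{ toFun := fun p => (p.1, fun n => logisticFlow (1 * G n p.1) (p.2 n))
            invFun := fun p => (p.1, fun n => logisticFlow (-1 * G n p.1) (p.2 n))
            left_inv := ?_
            right_inv := ?_
            continuous_toFun := hc 1
            continuous_invFun := hc (-1) }, ?_⟩
  · rintro ⟨a, b⟩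
    ext n
    · rfl
    · simp [logisticFlow_add, logisticFlow_zero]
  · rintro ⟨a, b⟩
    ext n
    · rfl
    · simp [logisticFlow_add, logisticFlow_zero]
  · intro x v
    simp [hG]

/-- The midpoint of the Hilbert cube. -/
noncomputable def cubeCenter : HilbertCube := fun _ => ⟨1 / 2, by norm_num, by norm_num⟩

lemma half_lt_logisticFlow_iff_neg_logit_lt (r : ℝ) {x : unitInterval}
    (hx : (x : ℝ) ∈ Ioo (0 : ℝ) 1) :
    1 / 2 < (logisticFlow r x : ℝ) ↔ -logit x < r := by
  have hx1 : (0 : ℝ) < 1 - x := by linarith [hx.2]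
  rw [half_lt_logisticFlow_iff, logit, ← Real.log_inv, inv_div,
    Real.log_lt_iff_lt_exp (div_pos hx1 hx.1), div_lt_iff₀ hx.1]

lemma logisticFlow_injective (r : ℝ) : Function.Injective (logisticFlow r) := by
  intro x y h
  have := congrArg (logisticFlow (-r)) h
  simpa [logisticFlow_add, logisticFlow_zero] using this

/-- A product of two zero-dimensional compacta in the pseudo-interior can be moved by a
homeomorphism into a prescribed copy of the Cantor cube in one factor. -/
theorem exists_homeomorph_straighten {X₁ X₂ : Type*} [TopologicalSpace X₁] [TopologicalSpace X₂]
    [CompactSpace X₁] [CompactSpace X₂] {a : X₁ → HilbertCube} {b : X₂ → HilbertCube}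
    (ha : Continuous a) (hb : Continuous b) (hai : Function.Injective a)
    (hbi : Function.Injective b) (ha' : ∀ x n, (a x n : ℝ) ∈ Ioo (0 : ℝ) 1)
    (hb' : ∀ x n, (b x n : ℝ) ∈ Ioo (0 : ℝ) 1)
    {γ₂ : X₂ → ℕ → Bool} (hγ₂ : Continuous γ₂) (hγ₂i : Function.Injective γ₂)
    {γ : X₁ × X₂ → ℕ → Bool} (hγ : Continuous γ) (hγi : Function.Injective γ)
    {F : (ℕ → Bool) → HilbertCube} (hF : Continuous F) (hFi : Function.Injective F)
    (hF' : ∀ c n, (F c n : ℝ) ∈ Ioo (0 : ℝ) 1) :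
    ∃ h : HilbertCube × HilbertCube ≃ₜ HilbertCube × HilbertCube,
      ∀ x y, ∃ c, h (a x, b y) = (cubeCenter, F c) := by
  have hN : ∀ n, ∃ N : ℝ, ∀ x, |logit (a x n)| < N := by
    intro n
    have hc : Continuous fun x => |logit (a x n)| :=
      (continuous_logit_comp (f := fun x => a x n) (by fun_prop) (fun x => ha' x n)).abs
    obtain ⟨C, hC⟩ := (isCompact_range hc).bddAbove
    exact ⟨C + 1, fun x => (hC (mem_range_self x)).trans_lt (lt_add_one C)⟩
  choose N hN using hN
  set s : X₂ → ℕ → ℝ := fun y n => if γ₂ y n then N n else -N n with hs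
  have hsc : Continuous s := by
    refine continuous_pi fun n => ?_
    exact (continuous_of_discreteTopology (f := fun t : Bool => if t then N n else -N n)).comp
      (by fun_prop : Continuous fun y => γ₂ y n)
  obtain ⟨h₁, hh₁⟩ := exists_shear hb hbi hsc
  set a' : X₁ × X₂ → HilbertCube := fun p n => logisticFlow (s p.2 n) (a p.1 n) with ha'def
  have ha'c : Continuous a' := by
    refine continuous_pi fun n => ?_
    exact continuous_logisticFlow.comp (by fun_prop :
      Continuous fun p : X₁ × X₂ => (s p.2 n, a p.1 n))
  have ha'i : ∀ p n, (a' p n : ℝ) ∈ Ioo (0 : ℝ) 1 := fun p n =>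
    logisticFlow_mem_Ioo _ (ha' _ _)
  have hdig : ∀ p n, 1 / 2 < (a' p n : ℝ) ↔ γ₂ p.2 n = true := by
    intro p n
    rw [ha'def]
    simp only
    rw [half_lt_logisticFlow_iff_neg_logit_lt _ (ha' _ _)]
    have := abs_lt.1 (hN n p.1)
    by_cases hg : γ₂ p.2 n = true
    · simp only [hs, hg, if_true, iff_true]; linarith
    · simp only [hs, hg]; simp; linarith
  have ha'inj : Function.Injective a' := by
    rintro ⟨x, y⟩ ⟨x', y'⟩ h
    have hy : y = y' := by
      apply hγ₂i
      funext n
      have h1 := hdig (x, y) n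
      have h2 := hdig (x', y') n
      rw [h, h2] at h1
      exact (Bool.eq_iff_iff.2 h1).symm
    subst hy
    have hx : x = x' := by
      apply hai
      funext n
      exact logisticFlow_injective _ (congrFun h n)
    rw [hx]
  have hFγ : Continuous fun p => F (γ p) := hF.comp hγ
  have hg₂ : Continuous fun (p : X₁ × X₂) (n : ℕ) => logit (F (γ p) n) - logit (b p.2 n) := by
    refine continuous_pi fun n => ?_
    exact (continuous_logit_comp (f := fun p => F (γ p) n) (by fun_prop) (fun p => hF' _ _)).sub
      (continuous_logit_comp (f := fun p : X₁ × X₂ => b p.2 n) (by fun_prop) (fun p => hb' _ _))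
  have hg₃ : Continuous fun (p : X₁ × X₂) (n : ℕ) => logit (cubeCenter n) - logit (a' p n) := by
    refine continuous_pi fun n => ?_
    exact continuous_const.sub
      (continuous_logit_comp (f := fun p => a' p n) (by fun_prop) (fun p => ha'i _ _))
  obtain ⟨h₂, hh₂⟩ := exists_shear ha'c ha'inj hg₂
  obtain ⟨h₃, hh₃⟩ := exists_shear hFγ (hFi.comp hγi) hg₃
  let sw := Homeomorph.prodComm HilbertCube HilbertCube
  refine ⟨(((sw.trans h₁).trans sw).trans h₂).trans ((sw.trans h₃).trans sw), fun x y => ?_⟩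
  refine ⟨γ (x, y), ?_⟩
  have e1 : sw (h₁ (sw (a x, b y))) = (a' (x, y), b y) := by
    change sw (h₁ (b y, a x)) = _
    rw [hh₁]; rfl
  have e2 : h₂ (a' (x, y), b y) = (a' (x, y), F (γ (x, y))) := by
    have := hh₂ (x, y) (b y)
    rw [this]
    congr 1
    funext n
    exact logisticFlow_logit_sub (hb' _ _) (hF' _ _)
  have e3 : sw (h₃ (sw (a' (x, y), F (γ (x, y))))) = (cubeCenter, F (γ (x, y))) := by
    change sw (h₃ (F (γ (x, y)), a' (x, y))) = _
    rw [hh₃ (x, y) (a' (x, y))]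
    change (_, _) = _
    congr 1
    funext n
    refine logisticFlow_logit_sub (ha'i _ _) ?_
    simp only [cubeCenter]; norm_num
  change sw (h₃ (sw (h₂ (sw (h₁ (sw (a x, b y))))))) = _
  rw [e1, e2, e3]

/-! ### Pushing products of nowhere dense sets into the pseudo-interior -/

/-- Truncation of a real number to the interval `[-t, t]`. -/
noncomputable def truncate (t x : ℝ) : ℝ := max (-t) (min x t)

lemma truncate_of_abs_le {t x : ℝ} (h : |x| ≤ t) : truncate t x = x := by
  have := abs_le.1 h
  rw [truncate, min_eq_left this.2, max_eq_right this.1]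

lemma truncate_of_le {t x : ℝ} (h0 : 0 ≤ t) (h : t ≤ x) : truncate t x = t := by
  rw [truncate, min_eq_right h, max_eq_right]; linarith

lemma truncate_of_le_neg {t x : ℝ} (h0 : 0 ≤ t) (h : x ≤ -t) : truncate t x = -t := by
  rw [truncate, min_eq_left (by linarith), max_eq_left h]

lemma abs_truncate_le {t : ℝ} (h0 : 0 ≤ t) (x : ℝ) : |truncate t x| ≤ t := by
  rw [abs_le, truncate]
  exact ⟨le_max_left _ _, max_le (by linarith) (min_le_right _ _)⟩

lemma abs_truncate_sub_truncate_le (t t' x : ℝ) : |truncate t x - truncate t' x| ≤ |t - t'| := by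
  refine (abs_max_sub_max_le_max _ _ _ _).trans (max_le ?_ ?_)
  · rw [neg_sub_neg, abs_sub_comm]
  · refine (abs_min_sub_min_le_max _ _ _ _).trans (max_le ?_ le_rfl)
    simp

/-- First coordinate of a piecewise linear involution of the square. -/
noncomputable def swapFst (l a b : ℝ) : ℝ := truncate (max |a| |b|) (b / l)

/-- Second coordinate of a piecewise linear involution of the square. -/
noncomputable def swapSnd (l a b : ℝ) : ℝ :=
  truncate (max (l * |a|) ((1 + l) * |a| - |b|)) a

lemma swap_of_abs_le {l a b : ℝ} (h0 : 0 < l) (h1 : l < 1) (h : |a| ≤ |b|) :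
    swapFst l a b = b ∧ swapSnd l a b = l * a := by
  have hbl : |b| ≤ |b| / l := by
    rw [le_div_iff₀ h0]; nlinarith [abs_nonneg b]
  constructor
  · rw [swapFst, max_eq_right h]
    rcases abs_cases b with ⟨hb, hs⟩ | ⟨hb, hs⟩
    · rw [hb] at hbl ⊢
      exact truncate_of_le hs hbl
    · rw [hb, neg_div] at hbl
      rw [hb, truncate_of_le_neg (by linarith) (by linarith), neg_neg]
  · rw [swapSnd, max_eq_left (by linarith)]
    have hla : l * |a| ≤ |a| := by nlinarith [abs_nonneg a]
    rcases abs_cases a with ⟨hb, hs⟩ | ⟨hb, hs⟩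
    · rw [hb] at hla ⊢
      exact truncate_of_le (by positivity) hla
    · rw [hb] at hla ⊢
      rw [truncate_of_le_neg (by nlinarith) (by linarith)]; ring

lemma swap_of_abs_le_mul {l a b : ℝ} (h0 : 0 < l) (h : |b| ≤ l * |a|) :
    swapFst l a b = b / l ∧ swapSnd l a b = a := by
  constructor
  · refine truncate_of_abs_le ?_
    rw [abs_div, abs_of_pos h0, div_le_iff₀ h0]
    exact h.trans (by rw [mul_comm]; gcongr; exact le_max_left _ _)
  · refine truncate_of_abs_le (le_trans ?_ (le_max_right _ _))
    linarith

lemma swap_of_between {l a b : ℝ} (h0 : 0 < l) (h : |b| ≤ |a|)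
    (h' : l * |a| ≤ |b|) :
    (0 ≤ a → swapSnd l a b = (1 + l) * |a| - |b|) ∧
    (a ≤ 0 → swapSnd l a b = -((1 + l) * |a| - |b|)) ∧
    (0 ≤ b → swapFst l a b = |a|) ∧ (b ≤ 0 → swapFst l a b = -|a|) := by
  have hab : |a| ≤ |b| / l := by rw [le_div_iff₀ h0]; linarith
  have h2 : 0 ≤ (1 + l) * |a| - |b| := by nlinarith [abs_nonneg a]
  have h3 : (1 + l) * |a| - |b| ≤ |a| := by linarith
  have hm : max (l * |a|) ((1 + l) * |a| - |b|) = (1 + l) * |a| - |b| :=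
    max_eq_right (by linarith)
  refine ⟨fun ha => ?_, fun ha => ?_, fun hb => ?_, fun hb => ?_⟩
  · rw [swapSnd, hm]
    exact truncate_of_le h2 (by rwa [abs_of_nonneg ha] at h3 ⊢)
  · rw [swapSnd, hm]
    refine truncate_of_le_neg h2 ?_
    rw [abs_of_nonpos ha] at h3 ⊢; linarith
  · rw [swapFst, max_eq_left h]
    refine truncate_of_le (abs_nonneg _) ?_
    rwa [abs_of_nonneg hb] at hab
  · rw [swapFst, max_eq_left h]
    refine truncate_of_le_neg (abs_nonneg _) ?_
    rw [abs_of_nonpos hb, neg_div] at hab; linarith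

lemma swap_swap {l : ℝ} (h0 : 0 < l) (h1 : l < 1) (a b : ℝ) :
    swapFst l (swapFst l a b) (swapSnd l a b) = a ∧
    swapSnd l (swapFst l a b) (swapSnd l a b) = b := by
  rcases le_total |a| |b| with h | h
  · obtain ⟨e1, e2⟩ := swap_of_abs_le h0 h1 h
    rw [e1, e2]
    obtain ⟨e3, e4⟩ := swap_of_abs_le_mul (a := b) (b := l * a) h0
      (by rw [abs_mul, abs_of_pos h0]; gcongr)
    rw [e3, e4]
    exact ⟨by field_simp, rfl⟩
  rcases le_total |b| (l * |a|) with h' | h'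
  · obtain ⟨e1, e2⟩ := swap_of_abs_le_mul h0 h'
    rw [e1, e2]
    obtain ⟨e3, e4⟩ := swap_of_abs_le (a := b / l) (b := a) h0 h1
      (by rw [abs_div, abs_of_pos h0, div_le_iff₀ h0]; linarith)
    rw [e3, e4]
    exact ⟨rfl, by field_simp⟩
  obtain ⟨p1, p2, p3, p4⟩ := swap_of_between h0 h h'
  have h2 : 0 ≤ (1 + l) * |a| - |b| := by nlinarith [abs_nonneg a]
  have e1 : |swapFst l a b| = |a| := by
    rcases le_total 0 b with hb | hb
    · rw [p3 hb, abs_abs]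
    · rw [p4 hb, abs_neg, abs_abs]
  have e2 : |swapSnd l a b| = (1 + l) * |a| - |b| := by
    rcases le_total 0 a with hb | hb
    · rw [p1 hb, abs_of_nonneg h2]
    · rw [p2 hb, abs_neg, abs_of_nonneg h2]
  obtain ⟨q1, q2, q3, q4⟩ := swap_of_between (a := swapFst l a b) (b := swapSnd l a b) h0
    (by rw [e1, e2]; linarith) (by rw [e1, e2]; linarith)
  rw [e1, e2] at q1 q2
  rw [e1] at q3 q4
  constructor
  · rcases le_total 0 a with ha | ha
    · rw [q3 (by rw [p1 ha]; exact h2), abs_of_nonneg ha]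
    · rw [q4 (by rw [p2 ha]; linarith), abs_of_nonpos ha, neg_neg]
  · rcases le_total 0 b with hb | hb
    · rw [q1 (by rw [p3 hb]; positivity), abs_of_nonneg hb]; ring
    · rw [q2 (by rw [p4 hb]; linarith [abs_nonneg a]), abs_of_nonpos hb]; ring

lemma abs_swapFst_le (l a b : ℝ) : |swapFst l a b| ≤ max |a| |b| :=
  abs_truncate_le (le_max_of_le_left (abs_nonneg _)) _

lemma abs_swapSnd_le {l : ℝ} (h0 : 0 < l) (a b : ℝ) :
    |swapSnd l a b| ≤ max (l * |a|) ((1 + l) * |a| - |b|) :=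
  abs_truncate_le (le_max_of_le_left (by positivity)) _

lemma abs_swapSnd_le_abs {l : ℝ} (h0 : 0 < l) (a b : ℝ) :
    |swapSnd l a b| ≤ |a| := by
  rw [swapSnd, abs_le, truncate]
  have hla : 0 ≤ max (l * |a|) ((1 + l) * |a| - |b|) :=
    le_max_of_le_left (by positivity)
  have h3 := neg_abs_le a
  have h4 := le_abs_self a
  refine ⟨le_max_of_le_right (le_min h3 (by linarith [abs_nonneg a])), max_le ?_ ?_⟩
  · linarith [abs_nonneg a]
  · exact (min_le_left _ _).trans h4

lemma abs_swapFst_sub_le (l a a' b : ℝ) : |swapFst l a b - swapFst l a' b| ≤ |a - a'| := by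
  refine (abs_truncate_sub_truncate_le _ _ _).trans ?_
  refine (abs_max_sub_max_le_max _ _ _ _).trans (max_le ?_ ?_)
  · exact abs_abs_sub_abs_le _ _
  · simp

lemma abs_swapFst_sub_self_le {l : ℝ} (h0 : 0 < l) (h1 : l < 1) (a b : ℝ) :
    |swapFst l a b - b| ≤ |b| * (1 / l - 1) := by
  have key : swapFst l a b = b ∨ |b| ≤ |swapFst l a b| ∧ |swapFst l a b| ≤ |b| / l ∧
      0 ≤ b * swapFst l a b := by
    right
    have hbl : |b| ≤ |b| / l := by
      rw [le_div_iff₀ h0]; nlinarith [abs_nonneg b]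
    rcases le_total |a| |b| with h | h
    · rw [(swap_of_abs_le h0 h1 h).1]
      exact ⟨le_rfl, hbl, mul_self_nonneg b⟩
    rcases le_total |b| (l * |a|) with h' | h'
    · rw [(swap_of_abs_le_mul h0 h').1]
      rw [abs_div, abs_of_pos h0]
      refine ⟨hbl, le_rfl, ?_⟩
      rw [mul_div_assoc']
      exact div_nonneg (mul_self_nonneg b) h0.le
    have hab : |a| ≤ |b| / l := by rw [le_div_iff₀ h0]; linarith
    obtain ⟨p1, p2, p3, p4⟩ := swap_of_between h0 h h'
    rcases le_total 0 b with hb | hb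
    · rw [p3 hb, abs_abs]
      exact ⟨h, hab, by positivity⟩
    · rw [p4 hb, abs_neg, abs_abs]
      exact ⟨h, hab, by nlinarith [abs_nonneg a]⟩
  have e : |b| * (1 / l - 1) = |b| / l - |b| := by ring
  rw [e]
  rcases key with h | ⟨k1, k2, k3⟩
  · rw [h]
    have hbl : |b| ≤ |b| / l := by
      rw [le_div_iff₀ h0]; nlinarith [abs_nonneg b]
    simpa using hbl
  · rcases lt_trichotomy b 0 with hb | hb | hb
    · have hs : swapFst l a b ≤ 0 := by
        by_contra hcon
        push Not at hcon
        nlinarith [mul_pos_of_neg_of_neg hb (neg_lt_zero.2 hcon)]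
      rw [abs_of_neg hb, abs_of_nonpos hs] at *
      rw [abs_le]; constructor <;> linarith
    · subst hb
      simp at k2 ⊢
      simp [k2]
    · have hs : 0 ≤ swapFst l a b := by
        by_contra hcon
        push Not at hcon
        nlinarith [mul_pos hb (neg_pos.2 hcon)]
      rw [abs_of_pos hb, abs_of_nonneg hs] at *
      rw [abs_le]; constructor <;> linarith

lemma continuous_swapFst (l : ℝ) : Continuous fun p : ℝ × ℝ => swapFst l p.1 p.2 := by
  unfold swapFst truncate; fun_prop

lemma continuous_swapSnd (l : ℝ) : Continuous fun p : ℝ × ℝ => swapSnd l p.1 p.2 := by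
  unfold swapSnd truncate; fun_prop


/-- The slopes used in the infinite composition of planar swaps. -/
noncomputable def swapSlope (n : ℕ) : ℝ := (n + 1) / (n + 2)

lemma swapSlope_pos (n : ℕ) : 0 < swapSlope n := by unfold swapSlope; positivity

lemma swapSlope_lt_one (n : ℕ) : swapSlope n < 1 := by
  unfold swapSlope; rw [div_lt_one (by positivity)]; linarith

lemma inv_swapSlope_sub_one (n : ℕ) : 1 / swapSlope n - 1 = 1 / (n + 1 : ℝ) := by
  unfold swapSlope; field_simp; ring

/-- The carried coordinate of the infinite composition of planar swaps. -/
noncomputable def carry (X : ℕ → ℝ) : ℕ → ℝ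
  | 0 => X 0
  | n + 1 => swapFst (swapSlope n) (carry X n) (X (n + 1))

/-- The infinite composition of planar swaps. -/
noncomputable def carryOut (X : ℕ → ℝ) (n : ℕ) : ℝ :=
  swapSnd (swapSlope n) (carry X n) (X (n + 1))

lemma abs_carry_le {X : ℕ → ℝ} (hX : ∀ n, |X n| ≤ 1) (n : ℕ) : |carry X n| ≤ 1 := by
  induction n with
  | zero => exact hX 0
  | succ n ih => exact (abs_swapFst_le _ _ _).trans (max_le ih (hX _))

lemma abs_carryOut_le {X : ℕ → ℝ} (hX : ∀ n, |X n| ≤ 1) (n : ℕ) : |carryOut X n| ≤ 1 :=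
  (abs_swapSnd_le_abs (swapSlope_pos n) _ _).trans (abs_carry_le hX n)

lemma abs_carryOut_lt_one {X : ℕ → ℝ} (hX : ∀ n, |X n| ≤ 1) {n : ℕ}
    (h : swapSlope n < |X (n + 1)|) : |carryOut X n| < 1 := by
  refine (abs_swapSnd_le (swapSlope_pos n) _ _).trans_lt (max_lt ?_ ?_)
  · have := abs_carry_le hX n
    nlinarith [swapSlope_pos n, swapSlope_lt_one n]
  · have := abs_carry_le hX n
    nlinarith [swapSlope_pos n, swapSlope_lt_one n]

lemma carry_eq (X : ℕ → ℝ) (n : ℕ) :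
    carry X n = swapFst (swapSlope n) (carry X (n + 1)) (carryOut X n) :=
  (swap_swap (swapSlope_pos n) (swapSlope_lt_one n) (carry X n) (X (n + 1))).1.symm

lemma apply_succ_eq (X : ℕ → ℝ) (n : ℕ) :
    X (n + 1) = swapSnd (swapSlope n) (carry X (n + 1)) (carryOut X n) :=
  (swap_swap (swapSlope_pos n) (swapSlope_lt_one n) (carry X n) (X (n + 1))).2.symm

lemma continuous_carry (n : ℕ) : Continuous fun X : ℕ → ℝ => carry X n := by
  induction n with
  | zero => exact continuous_apply 0
  | succ n ih =>
    exact (continuous_swapFst _).comp (ih.prodMk (continuous_apply (n + 1)))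

lemma continuous_carryOut : Continuous carryOut := by
  refine continuous_pi fun n => ?_
  exact (continuous_swapSnd _).comp ((continuous_carry n).prodMk (continuous_apply (n + 1)))

lemma carryOut_injOn {X X' : ℕ → ℝ} (hX : ∀ n, |X n| ≤ 1)
    (h : carryOut X = carryOut X') : X = X' := by
  have hy := abs_carryOut_le hX
  have step : ∀ n, |carry X n - carry X' n| ≤ |carry X (n + 1) - carry X' (n + 1)| := by
    intro n
    rw [carry_eq X n, carry_eq X' n, ← h]
    exact abs_swapFst_sub_le _ _ _ _
  have small : ∀ n, |carry X n - carry X' n| ≤ 2 * (1 / (n + 1 : ℝ)) := by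
    intro n
    rw [carry_eq X n, carry_eq X' n, ← h]
    have b := fun c => abs_swapFst_sub_self_le (swapSlope_pos n) (swapSlope_lt_one n) c (carryOut X n)
    rw [inv_swapSlope_sub_one] at b
    have b1 := b (carry X (n + 1))
    have b2 := b (carry X' (n + 1))
    have hp : (0 : ℝ) < 1 / (n + 1) := by positivity
    have b3 : |carryOut X n| * (1 / (n + 1 : ℝ)) ≤ 1 / (n + 1) := by nlinarith [hy n]
    rw [abs_le] at *
    constructor <;> linarith
  have mono : ∀ n m, n ≤ m → |carry X n - carry X' n| ≤ |carry X m - carry X' m| := by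
    intro n m hnm
    exact monotone_nat_of_le_succ (f := fun n => |carry X n - carry X' n|) step hnm
  have eqc : ∀ n, carry X n = carry X' n := by
    intro n
    have hle : |carry X n - carry X' n| ≤ 0 := by
      have ht : Filter.Tendsto (fun m : ℕ => 2 * (1 / ((m : ℝ) + 1))) Filter.atTop (𝓝 (2 * 0)) :=
        tendsto_one_div_add_atTop_nhds_zero_nat.const_mul 2
      rw [mul_zero] at ht
      refine ge_of_tendsto ht ?_
      filter_upwards [Filter.eventually_ge_atTop n] with m hm
      exact (mono n m hm).trans (small m)
    exact sub_eq_zero.1 (abs_nonpos_iff.1 hle)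
  funext n
  cases n with
  | zero => exact eqc 0
  | succ n => rw [apply_succ_eq X n, apply_succ_eq X' n, eqc, h]

lemma exists_carryOut_eq_lt (m : ℕ) : ∀ {y : ℕ → ℝ}, (∀ n, |y n| ≤ 1) → ∀ d : ℝ, |d| ≤ 1 →
    ∃ X : ℕ → ℝ, (∀ n, |X n| ≤ 1) ∧ carry X m = d ∧ ∀ n < m, carryOut X n = y n := by
  induction m with
  | zero =>
    intro y _ d hd
    exact ⟨fun _ => d, fun _ => hd, rfl, by simp⟩
  | succ m ih =>
    intro y hy d hd
    obtain ⟨X, hX, hc, ho⟩ := ih hy (swapFst (swapSlope m) d (y m))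
      ((abs_swapFst_le _ _ _).trans (max_le hd (hy m)))
    set X' : ℕ → ℝ := Function.update X (m + 1) (swapSnd (swapSlope m) d (y m)) with hX'
    have agree : ∀ n ≤ m, X' n = X n := fun n hn => by
      rw [hX', Function.update_of_ne]; omega
    have hcarry : ∀ n ≤ m, carry X' n = carry X n := by
      intro n
      induction n with
      | zero => intro _; exact agree 0 (Nat.zero_le _)
      | succ n ihn =>
        intro hn
        rw [carry, carry, ihn (by omega), agree _ hn]
    have hlast : X' (m + 1) = swapSnd (swapSlope m) d (y m) := by simp [hX']
    have hs := swap_swap (swapSlope_pos m) (swapSlope_lt_one m) d (y m)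
    refine ⟨X', ?_, ?_, ?_⟩
    · intro n
      rcases eq_or_ne n (m + 1) with rfl | hn
      · rw [hlast]
        exact (abs_swapSnd_le_abs (swapSlope_pos m) _ _).trans hd
      · rw [hX', Function.update_of_ne hn]; exact hX n
    · rw [carry, hcarry m le_rfl, hlast, hc]
      exact hs.1
    · intro n hn
      rcases Nat.lt_succ_iff_lt_or_eq.1 hn with h | rfl
      · rw [← ho n h, carryOut, carryOut, hcarry n h.le, agree _ h]
      · rw [carryOut, hcarry n le_rfl, hlast, hc]
        exact hs.2

lemma abs_two_mul_sub_one_le (x : unitInterval) : |2 * (x : ℝ) - 1| ≤ 1 := by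
  rw [abs_le]; constructor <;> linarith [x.2.1, x.2.2]

/-- The infinite composition of planar swaps as a self-map of the Hilbert cube. -/
noncomputable def cubeCarry (x : HilbertCube) : HilbertCube := fun n =>
  ⟨(carryOut (fun n => 2 * (x n : ℝ) - 1) n + 1) / 2, by
    have := abs_le.1 (abs_carryOut_le (fun n => abs_two_mul_sub_one_le (x n)) n)
    constructor <;> linarith⟩

lemma continuous_cubeCarry : Continuous cubeCarry := by
  refine continuous_pi fun n => Continuous.subtype_mk ?_ _
  have h : Continuous fun x : HilbertCube => carryOut (fun n => 2 * (x n : ℝ) - 1) :=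
    continuous_carryOut.comp (by fun_prop)
  exact (((continuous_apply n).comp h).add continuous_const).div_const _

lemma cubeCarry_injective : Function.Injective cubeCarry := by
  intro x x' h
  have := carryOut_injOn (X' := fun n => 2 * (x' n : ℝ) - 1)
    (fun n => abs_two_mul_sub_one_le (x n)) (by
      funext n
      have := congrArg Subtype.val (congrFun h n)
      simp only [cubeCarry] at this
      linarith)
  funext n
  ext
  have := congrFun this n
  linarith

lemma cubeCarry_surjective : Function.Surjective cubeCarry := by
  intro y
  have hcl : IsClosed (range cubeCarry) := (isCompact_range continuous_cubeCarry).isClosed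
  have hx : ∀ m : ℕ, ∃ x, ∀ n < m, cubeCarry x n = y n := by
    intro m
    obtain ⟨X, hX, -, ho⟩ := exists_carryOut_eq_lt m (y := fun n => 2 * (y n : ℝ) - 1)
      (fun n => abs_two_mul_sub_one_le (y n)) 0 (by simp)
    refine ⟨fun n => ⟨(X n + 1) / 2, ?_⟩, ?_⟩
    · have := abs_le.1 (hX n)
      constructor <;> linarith
    · intro n hn
      ext
      have e : (fun n => 2 * ((X n + 1) / 2) - 1) = X := by funext n; ring
      simp only [cubeCarry, e, ho n hn]
      ring
  choose x hx using hx
  change y ∈ range cubeCarry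
  refine hcl.mem_of_tendsto (b := Filter.atTop) (f := fun m => cubeCarry (x m)) ?_
    (Filter.Eventually.of_forall fun m => mem_range_self _)
  rw [tendsto_pi_nhds]
  intro n
  refine tendsto_const_nhds.congr' ?_
  filter_upwards [Filter.eventually_gt_atTop n] with m hm
  exact (hx m n hm).symm

/-- The infinite composition of planar swaps as a homeomorphism of the Hilbert cube. -/
noncomputable def cubeCarryHomeo : HilbertCube ≃ₜ HilbertCube :=
  continuous_cubeCarry.homeoOfEquivCompactToT2
    (f := Equiv.ofBijective cubeCarry ⟨cubeCarry_injective, cubeCarry_surjective⟩)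

lemma cubeCarry_mem_Ioo {x : HilbertCube} {n : ℕ}
    (h : swapSlope n < |2 * (x (n + 1) : ℝ) - 1|) : (cubeCarry x n : ℝ) ∈ Ioo (0 : ℝ) 1 := by
  have := abs_lt.1 (abs_carryOut_lt_one (fun n => abs_two_mul_sub_one_le (x n)) h)
  simp only [cubeCarry]
  constructor <;> linarith

/-- A homeomorphism of the interval pushing the complement of a subinterval to the ends. -/
lemma exists_homeomorph_push_to_ends {u v e : ℝ} (hu : 0 ≤ u) (huv : u < v) (hv : v ≤ 1)
    (he0 : 0 < e) (he1 : e < 1) : ∃ φ : unitInterval ≃ₜ unitInterval,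
      ∀ x : unitInterval, (x : ℝ) ∉ Ioo u v → 1 - 2 * e ≤ |2 * (φ x : ℝ) - 1| := by
  set p : ℝ → ℝ := fun x => e * x + (1 - e) * ((max u (min x v) - u) / (v - u)) with hp
  have hvu : 0 < v - u := by linarith
  have hpc : Continuous p := by
    rw [hp]
    fun_prop
  have hpm : StrictMono p := by
    intro x y hxy
    have : max u (min x v) ≤ max u (min y v) := max_le_max le_rfl (min_le_min hxy.le le_rfl)
    have h2 : (max u (min x v) - u) / (v - u) ≤ (max u (min y v) - u) / (v - u) := by gcongr
    have h3 := mul_le_mul_of_nonneg_left h2 (by linarith : (0 : ℝ) ≤ 1 - e)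
    have h4 := mul_lt_mul_of_pos_left hxy he0
    simp only [hp]; linarith
  have hlow : ∀ x ≤ u, p x = e * x := by
    intro x hx
    simp only [hp]
    rw [min_eq_left (by linarith), max_eq_left hx]; simp
  have hhigh : ∀ x, v ≤ x → p x = e * x + (1 - e) := by
    intro x hx
    simp only [hp]
    rw [min_eq_right hx, max_eq_right huv.le, div_self hvu.ne']; ring
  have p0 : p 0 = 0 := by rw [hlow 0 hu]; ring
  have p1 : p 1 = 1 := by rw [hhigh 1 hv]; ring
  have hmem : ∀ x : unitInterval, p x ∈ Icc (0 : ℝ) 1 := fun x =>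
    ⟨p0 ▸ hpm.monotone x.2.1, p1 ▸ hpm.monotone x.2.2⟩
  let f : unitInterval → unitInterval := fun x => ⟨p x, hmem x⟩
  have fc : Continuous f := Continuous.subtype_mk (by fun_prop) _
  have fb : Function.Bijective f := by
    constructor
    · intro x y h
      exact Subtype.ext (hpm.injective (congrArg Subtype.val h))
    · intro y
      have := intermediate_value_Icc (zero_le_one) hpc.continuousOn
      rw [p0, p1] at this
      obtain ⟨x, hx, hxy⟩ := this y.2
      exact ⟨⟨x, hx⟩, Subtype.ext hxy⟩
  refine ⟨fc.homeoOfEquivCompactToT2 (f := Equiv.ofBijective f fb), fun x hx => ?_⟩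
  change 1 - 2 * e ≤ |2 * p x - 1|
  rcases le_or_gt (x : ℝ) u with h | h
  · rw [hlow _ h, le_abs]
    right; nlinarith [x.2.1, x.2.2]
  · have hvx : v ≤ x := by
      by_contra hcon
      exact hx ⟨h, not_le.1 hcon⟩
    rw [hhigh _ hvx, le_abs]
    left; nlinarith [x.2.1, x.2.2]

lemma exists_Ioo_disjoint {K : Set unitInterval} (hK : IsClosed K) (hn : interior K = ∅) :
    ∃ u v : ℝ, 0 ≤ u ∧ u < v ∧ v ≤ 1 ∧ ∀ x ∈ K, (x : ℝ) ∉ Ioo u v := by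
  have hd : Dense Kᶜ := interior_eq_empty_iff_dense_compl.1 hn
  let m : unitInterval := ⟨1 / 2, by norm_num, by norm_num⟩
  have ho : IsOpen {x : unitInterval | (x : ℝ) ∈ Ioo (0 : ℝ) 1} :=
    isOpen_Ioo.preimage continuous_subtype_val
  obtain ⟨x, hx, hxK⟩ := hd.inter_open_nonempty _ ho ⟨m, by constructor <;> norm_num [m]⟩
  obtain ⟨U, hU, hUK⟩ := isOpen_induced_iff.1 hK.isOpen_compl
  have hxU : (x : ℝ) ∈ U ∩ Ioo (0 : ℝ) 1 := ⟨by
    have : x ∈ Subtype.val ⁻¹' U := by rw [hUK]; exact hxK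
    exact this, hx⟩
  obtain ⟨u, v, hxuv, hsub⟩ := mem_nhds_iff_exists_Ioo_subset.1
    ((hU.inter isOpen_Ioo).mem_nhds hxU)
  have huv : u < v := hxuv.1.trans hxuv.2
  have hcl : Icc u v ⊆ Icc (0 : ℝ) 1 := by
    rw [← closure_Ioo huv.ne, ← closure_Ioo (zero_lt_one' ℝ).ne]
    exact closure_mono (hsub.trans inter_subset_right)
  refine ⟨u, v, (hcl (left_mem_Icc.2 huv.le)).1, huv, (hcl (right_mem_Icc.2 huv.le)).2, ?_⟩
  intro y hy hyuv
  have : y ∈ Kᶜ := by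
    rw [← hUK]; exact (hsub hyuv).1
  exact this hy

/-- Products of closed nowhere dense sets can be pushed into the pseudo-interior. -/
theorem exists_homeomorph_pseudoInterior {K : ℕ → Set unitInterval} (hK : ∀ i, IsClosed (K i))
    (hn : ∀ i, interior (K i) = ∅) : ∃ θ : HilbertCube ≃ₜ HilbertCube,
      ∀ x : HilbertCube, (∀ i, x i ∈ K i) → ∀ n, (θ x n : ℝ) ∈ Ioo (0 : ℝ) 1 := by
  choose u v hu huv hv hd using fun i => exists_Ioo_disjoint (hK i) (hn i)
  have he : ∀ i : ℕ, 0 < (1 - swapSlope (i - 1)) / 3 := fun i => by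
    have := swapSlope_lt_one (i - 1); linarith
  have he1 : ∀ i : ℕ, (1 - swapSlope (i - 1)) / 3 < 1 := fun i => by
    have := swapSlope_pos (i - 1); linarith
  choose φ hφ using fun i => exists_homeomorph_push_to_ends (hu i) (huv i) (hv i) (he i) (he1 i)
  refine ⟨(Homeomorph.piCongrRight φ).trans cubeCarryHomeo, fun x hx n => ?_⟩
  change (cubeCarry (fun i => φ i (x i)) n : ℝ) ∈ _
  refine cubeCarry_mem_Ioo ?_
  have := hφ (n + 1) (x (n + 1)) (hd _ _ (hx _))
  simp only [Nat.add_sub_cancel] at this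
  have h1 := swapSlope_lt_one n
  refine lt_of_lt_of_le ?_ this
  linarith

/-! ### Straightening products of nowhere dense sets -/

lemma exists_dense_seq_avoiding {K : Set unitInterval} (hn : interior K = ∅) :
    ∃ q : ℕ → unitInterval, DenseRange q ∧ ∀ n, q n ∉ K := by
  have hd : Dense Kᶜ := interior_eq_empty_iff_dense_compl.1 hn
  obtain ⟨D, hDK, hDc, hDd⟩ := hd.exists_countable_dense_subset
  obtain ⟨q, rfl⟩ := hDc.exists_eq_range hDd.nonempty
  exact ⟨q, hDd, fun n => hDK (mem_range_self n)⟩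

lemma exists_continuous_injective_bool {K : ℕ → Set unitInterval} (hn : ∀ i, interior (K i) = ∅) :
    ∃ γ : {x : HilbertCube // ∀ i, x i ∈ K i} → ℕ → Bool,
      Continuous γ ∧ Function.Injective γ := by
  choose q hqd hqK using fun i => exists_dense_seq_avoiding (hn i)
  refine ⟨fun x k => decide (x.1 k.unpair.1 < q k.unpair.1 k.unpair.2), ?_, ?_⟩
  · refine continuous_pi fun k => ?_
    rw [continuous_bool_rng true]
    have hpre : (fun x : {x : HilbertCube // ∀ i, x i ∈ K i} =>
        decide (x.1 k.unpair.1 < q k.unpair.1 k.unpair.2)) ⁻¹' {true} =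
        {x | x.1 k.unpair.1 < q k.unpair.1 k.unpair.2} := by
      ext x; simp
    have hc : Continuous fun x : {x : HilbertCube // ∀ i, x i ∈ K i} => x.1 k.unpair.1 :=
      (continuous_apply _).comp continuous_subtype_val
    rw [hpre]
    refine ⟨?_, isOpen_lt hc continuous_const⟩
    have : {x : {x : HilbertCube // ∀ i, x i ∈ K i} |
        x.1 k.unpair.1 < q k.unpair.1 k.unpair.2} =
        {x | x.1 k.unpair.1 ≤ q k.unpair.1 k.unpair.2} := by
      ext x
      simp only [mem_ofPred_eq]
      refine ⟨le_of_lt, fun h => lt_of_le_of_ne h fun e => ?_⟩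
      exact hqK k.unpair.1 k.unpair.2 (e ▸ x.2 _)
    rw [this]
    exact isClosed_le hc continuous_const
  · intro x y h
    ext i : 2
    have key : ∀ x y : {x : HilbertCube // ∀ i, x i ∈ K i},
        (fun k : ℕ => decide (x.1 k.unpair.1 < q k.unpair.1 k.unpair.2)) =
        (fun k : ℕ => decide (y.1 k.unpair.1 < q k.unpair.1 k.unpair.2)) → ¬ x.1 i < y.1 i := by
      intro x y h hlt
      obtain ⟨_, ⟨n, rfl⟩, h1, h2⟩ := (hqd i).exists_between hlt
      have := congrFun h (Nat.pair i n)
      simp only [Nat.unpair_pair, decide_eq_decide] at this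
      exact absurd (this.1 h1) (not_lt.2 h2.le)
    exact le_antisymm (not_lt.1 (key y x h.symm)) (not_lt.1 (key x y h))

/-- The Hilbert cube is homeomorphic to its square via even and odd coordinates. -/
def cubeSplit : HilbertCube ≃ₜ HilbertCube × HilbertCube where
  toFun x := (fun n => x (2 * n), fun n => x (2 * n + 1))
  invFun p n := if n % 2 = 0 then p.1 (n / 2) else p.2 (n / 2)
  left_inv x := by
    funext n
    rcases Nat.mod_two_eq_zero_or_one n with h | h
    · simp only [h, if_true]; congr 1; omega
    · simp only [h]; rw [if_neg (by omega)]; congr 1; omega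
  right_inv p := by
    refine Prod.ext ?_ ?_
    · funext n
      simp
    · funext n
      have h1 : (2 * n + 1) % 2 ≠ 0 := by omega
      have h2 : (2 * n + 1) / 2 = n := by omega
      simp only [h1, if_false, h2]
  continuous_toFun := by fun_prop
  continuous_invFun := by
    refine continuous_pi fun n => ?_
    split_ifs <;> fun_prop

theorem exists_homeomorph_product_straighten {K : ℕ → Set unitInterval}
    (hK : ∀ i, IsClosed (K i)) (hn : ∀ i, interior (K i) = ∅)
    {F : (ℕ → Bool) → HilbertCube} (hF : Continuous F) (hFi : Function.Injective F)
    (hF' : ∀ c n, (F c n : ℝ) ∈ Ioo (0 : ℝ) 1) :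
    ∃ H : HilbertCube ≃ₜ HilbertCube × HilbertCube,
      ∀ x : HilbertCube, (∀ i, x i ∈ K i) → ∃ c, H x = (cubeCenter, F c) := by
  have hcomp : ∀ L : ℕ → Set unitInterval, (∀ i, IsClosed (L i)) →
      CompactSpace {x : HilbertCube // ∀ i, x i ∈ L i} := by
    intro L hL
    have hcl : IsClosed {x : HilbertCube | ∀ i, x i ∈ L i} := ?_
    · exact isCompact_iff_compactSpace.1 hcl.isCompact
    have : {x : HilbertCube | ∀ i, x i ∈ L i} = ⋂ i, (fun x : HilbertCube => x i) ⁻¹' L i := by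
      ext x; simp
    rw [this]
    exact isClosed_iInter fun i => (hL i).preimage (continuous_apply i)
  set K₁ : ℕ → Set unitInterval := fun i => K (2 * i)
  set K₂ : ℕ → Set unitInterval := fun i => K (2 * i + 1)
  have := hcomp K₁ (fun i => hK _)
  have := hcomp K₂ (fun i => hK _)
  obtain ⟨θ₁, hθ₁⟩ := exists_homeomorph_pseudoInterior (K := K₁) (fun i => hK _) (fun i => hn _)
  obtain ⟨θ₂, hθ₂⟩ := exists_homeomorph_pseudoInterior (K := K₂) (fun i => hK _) (fun i => hn _)
  obtain ⟨γ₁, hγ₁, hγ₁i⟩ := exists_continuous_injective_bool (K := K₁) (fun i => hn _)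
  obtain ⟨γ₂, hγ₂, hγ₂i⟩ := exists_continuous_injective_bool (K := K₂) (fun i => hn _)
  let γ : {x : HilbertCube // ∀ i, x i ∈ K₁ i} × {x : HilbertCube // ∀ i, x i ∈ K₂ i} →
      ℕ → Bool := fun p n => if n % 2 = 0 then γ₁ p.1 (n / 2) else γ₂ p.2 (n / 2)
  have hγ : Continuous γ := by
    refine continuous_pi fun n => ?_
    simp only [γ]
    split_ifs <;> fun_prop
  have hγi : Function.Injective γ := by
    rintro ⟨x, y⟩ ⟨x', y'⟩ h
    refine Prod.ext (hγ₁i ?_) (hγ₂i ?_)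
    · funext n
      have := congrFun h (2 * n)
      simpa [γ] using this
    · funext n
      have := congrFun h (2 * n + 1)
      simp only [γ] at this
      rw [if_neg (by omega), if_neg (by omega)] at this
      rwa [show (2 * n + 1) / 2 = n by omega] at this
  obtain ⟨h, hh⟩ := exists_homeomorph_straighten
    (a := fun x : {x : HilbertCube // ∀ i, x i ∈ K₁ i} => θ₁ x.1)
    (b := fun x : {x : HilbertCube // ∀ i, x i ∈ K₂ i} => θ₂ x.1)
    (by fun_prop) (by fun_prop)
    (θ₁.injective.comp Subtype.val_injective) (θ₂.injective.comp Subtype.val_injective)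
    (fun x n => hθ₁ x.1 x.2 n) (fun x n => hθ₂ x.1 x.2 n) hγ₂ hγ₂i hγ hγi hF hFi hF'
  refine ⟨(cubeSplit.trans (θ₁.prodCongr θ₂)).trans h, fun x hx => ?_⟩
  obtain ⟨c, hc⟩ := hh ⟨fun n => x (2 * n), fun i => hx _⟩ ⟨fun n => x (2 * n + 1), fun i => hx _⟩
  exact ⟨c, hc⟩

/-! ### Cantor sets contain products of nowhere dense sets -/

lemma neBot_nhdsWithin_cantor (x : ℕ → Bool) : (𝓝[≠] x).NeBot := by
  have ht : Filter.Tendsto (fun n => Function.update x n (!x n)) Filter.atTop (𝓝[≠] x) := by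
    refine tendsto_nhdsWithin_iff.2 ⟨?_, Filter.Eventually.of_forall fun n => ?_⟩
    · rw [tendsto_pi_nhds]
      intro i
      refine tendsto_const_nhds.congr' ?_
      filter_upwards [Filter.eventually_gt_atTop i] with n hn
      rw [Function.update_of_ne hn.ne]
    · intro h
      have := congrFun h n
      simp at this
  exact ht.neBot

lemma dense_compl_of_countable {X : Type*} [TopologicalSpace X] [T1Space X] [BaireSpace X]
    (hX : ∀ x : X, (𝓝[≠] x).NeBot) {C : Set X} (hC : C.Countable) : Dense Cᶜ := by
  have : Cᶜ = ⋂ c ∈ C, {c}ᶜ := by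
    ext x; simp only [mem_compl_iff, mem_iInter, mem_singleton_iff]
    exact ⟨fun h i hi e => h (e ▸ hi), fun h hx => h x hx rfl⟩
  rw [this]
  refine dense_biInter_of_isOpen (fun c _ => isOpen_compl_singleton) hC fun c _ => ?_
  have := hX c
  exact dense_compl_singleton c

lemma exists_cantor_subset_of_isGδ {G : Set (ℕ → Bool)} (hG : IsGδ G) (hGunc : ¬ G.Countable) :
    ∃ g : (ℕ → Bool) → ℕ → Bool, range g ⊆ G ∧ Continuous g ∧ Function.Injective g := by
  have hGm : MeasurableSet G := hG.measurableSet
  have hP : PolishSpace (ℕ → Bool) := {}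
  obtain ⟨t', ht', hpol, hcl, -⟩ := hGm.isClopenable
  obtain ⟨g, hgG, hgc, hgi⟩ :=
    @IsClosed.exists_nat_bool_injection_of_not_countable (ℕ → Bool) t' hpol G hcl hGunc
  exact ⟨g, hgG, continuous_iff_coinduced_le.2 ((continuous_iff_coinduced_le.1 hgc).trans ht'), hgi⟩

theorem exists_subcantor_subset_product {f : (ℕ → Bool) → HilbertCube} (hf : Continuous f) :
    ∃ g : (ℕ → Bool) → ℕ → Bool, Continuous g ∧ Function.Injective g ∧
      ∃ K : ℕ → Set unitInterval, (∀ i, IsClosed (K i)) ∧ (∀ i, interior (K i) = ∅) ∧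
        ∀ c i, f (g c) i ∈ K i := by
  have hfi : ∀ i, Continuous fun c => f c i := fun i => (continuous_apply i).comp hf
  have hD : ∀ i, ∃ D : Set unitInterval, D.Countable ∧ Dense D ∧
      ∀ d ∈ D, interior ((fun c => f c i) ⁻¹' {d}) = ∅ := by
    intro i
    have hC : {d : unitInterval | (interior ((fun c => f c i) ⁻¹' {d})).Nonempty}.Countable := by
      refine Set.PairwiseDisjoint.countable_of_isOpen
        (s := fun d => interior ((fun c => f c i) ⁻¹' {d})) ?_ (fun d _ => isOpen_interior)
        (fun d hd => hd)
      intro d _ e _ hde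
      refine Disjoint.mono interior_subset interior_subset ?_
      rw [disjoint_left]
      intro c h1 h2
      exact hde (h1.symm.trans h2)
    obtain ⟨D, hDC, hDc, hDd⟩ := (dense_compl_of_countable
      (fun x : unitInterval => inferInstance) hC).exists_countable_dense_subset
    exact ⟨D, hDc, hDd, fun d hd => not_nonempty_iff_eq_empty.1 (hDC hd)⟩
  choose D hDc hDd hDi using hD
  set G : Set (ℕ → Bool) := ⋂ i, ⋂ d ∈ D i, ((fun c => f c i) ⁻¹' {d})ᶜ with hG
  have hGδ : IsGδ G := by
    refine IsGδ.iInter fun i => IsGδ.biInter (hDc i) fun d _ => ?_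
    exact (isClosed_singleton.preimage (hfi i)).isOpen_compl.isGδ
  have hGres : G ∈ residual (ℕ → Bool) := by
    rw [hG, countable_iInter_mem]
    intro i
    rw [countable_bInter_mem (hDc i)]
    intro d hd
    exact residual_of_dense_open (isClosed_singleton.preimage (hfi i)).isOpen_compl
      (interior_eq_empty_iff_dense_compl.1 (hDi i d hd))
  have hGunc : ¬ G.Countable := by
    intro hc
    have h1 : Dense (G ∩ Gᶜ) := by
      refine dense_of_mem_residual (Filter.inter_mem hGres ?_)
      have : Gᶜ = ⋂ c ∈ G, {c}ᶜ := by
        ext x; simp only [mem_compl_iff, mem_iInter, mem_singleton_iff]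
        exact ⟨fun h i hi e => h (e ▸ hi), fun h hx => h x hx rfl⟩
      rw [this, countable_bInter_mem hc]
      intro c _
      have := neBot_nhdsWithin_cantor c
      exact residual_of_dense_open isOpen_compl_singleton (dense_compl_singleton c)
    rw [inter_compl_self] at h1
    exact not_nonempty_empty h1.nonempty
  obtain ⟨g, hgG, hgc', hgi⟩ := exists_cantor_subset_of_isGδ hGδ hGunc
  refine ⟨g, hgc', hgi, fun i => range fun c => f (g c) i, fun i => ?_, fun i => ?_, fun c i => ?_⟩
  · exact (isCompact_range ((hfi i).comp hgc')).isClosed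
  · refine interior_eq_empty_iff_dense_compl.2 ((hDd i).mono ?_)
    rintro d hd ⟨c, hc⟩
    have := hgG (mem_range_self c)
    simp only [hG, mem_iInter] at this
    exact this i d hd hc
  · exact mem_range_self c

/-- Any Cantor set in the Hilbert cube contains a homeomorphic copy, under an ambient
homeomorphism, of any given product of closed nowhere dense sets. -/
theorem exists_homeomorph_product_into_range {K : ℕ → Set unitInterval}
    (hK : ∀ i, IsClosed (K i)) (hn : ∀ i, interior (K i) = ∅)
    {f : (ℕ → Bool) → HilbertCube} (hf : Continuous f) (hfi : Function.Injective f) :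
    ∃ h : HilbertCube ≃ₜ HilbertCube,
      ∀ x : HilbertCube, (∀ i, x i ∈ K i) → h x ∈ range f := by
  obtain ⟨g, hg, hgi, K', hK', hn', hgK⟩ := exists_subcantor_subset_product hf
  let F₀ : (ℕ → Bool) → HilbertCube := fun c n =>
    if c n then ⟨1 / 4, by norm_num, by norm_num⟩ else ⟨3 / 4, by norm_num, by norm_num⟩
  have hF₀ : Continuous F₀ := by
    refine continuous_pi fun n => ?_
    exact (continuous_of_discreteTopology (f := fun t : Bool => if t then
      (⟨1 / 4, by norm_num, by norm_num⟩ : unitInterval) else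
      ⟨3 / 4, by norm_num, by norm_num⟩)).comp (continuous_apply n)
  have hF₀i : Function.Injective F₀ := by
    intro c d h
    funext n
    have := congrArg Subtype.val (congrFun h n)
    simp only [F₀] at this
    cases hc : c n <;> cases hd : d n <;> simp [hc, hd] at this ⊢ <;> norm_num at this
  obtain ⟨H₁, hH₁⟩ := exists_homeomorph_product_straighten hK' hn' hF₀ hF₀i (by
    intro c n
    simp only [F₀]
    split_ifs <;> norm_num)
  have hval : ∀ c, ∃ d, H₁ (f (g c)) = (cubeCenter, F₀ d) := fun c => hH₁ _ (hgK c)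
  obtain ⟨H₂, hH₂⟩ := exists_homeomorph_product_straighten hK hn
    (F := fun c => (H₁ (f (g c))).2) (by fun_prop) (by
      intro c d h
      obtain ⟨c', hc'⟩ := hval c
      obtain ⟨d', hd'⟩ := hval d
      refine hgi (hfi (H₁.injective (Prod.ext ?_ h)))
      rw [hc', hd']) (by
      intro c n
      obtain ⟨c', hc'⟩ := hval c
      simp only [hc', F₀]
      split_ifs <;> norm_num)
  refine ⟨H₂.trans H₁.symm, fun x hx => ?_⟩
  obtain ⟨c, hc⟩ := hH₂ x hx
  refine ⟨g c, ?_⟩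
  obtain ⟨c', hc'⟩ := hval c
  rw [Homeomorph.trans_apply, hc, Homeomorph.eq_symm_apply]
  rw [hc']

/-! ### Minimal Cantor sets -/

lemma IsCantorSet.exists_param {B : Set HilbertCube} (hB : IsCantorSet B) :
    ∃ f : (ℕ → Bool) → HilbertCube, Continuous f ∧ Function.Injective f ∧ range f = B := by
  obtain ⟨e⟩ := hB
  refine ⟨fun c => (e.symm c : HilbertCube), by fun_prop,
    Subtype.val_injective.comp e.symm.injective, ?_⟩
  change range (Subtype.val ∘ e.symm) = B
  rw [e.symm.surjective.range_comp, Subtype.range_coe]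

lemma isCantorSet_range {f : (ℕ → Bool) → HilbertCube} (hf : Continuous f)
    (hfi : Function.Injective f) : IsCantorSet (range f) :=
  ⟨(hf.isClosedEmbedding hfi).isEmbedding.toHomeomorph.symm⟩

/-- The standard embedding of the Cantor cube onto the vertices of the Hilbert cube. -/
def cubeVertex (c : ℕ → Bool) : HilbertCube := fun n => if c n then 1 else 0

lemma continuous_cubeVertex : Continuous cubeVertex := by
  refine continuous_pi fun n => ?_
  exact (continuous_of_discreteTopology
    (f := fun t : Bool => if t then (1 : unitInterval) else 0)).comp (continuous_apply n)

lemma cubeVertex_injective : Function.Injective cubeVertex := by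
  intro c d h
  funext n
  have := congrFun h n
  simp only [cubeVertex] at this
  cases hc : c n <;> cases hd : d n <;> simp [hc, hd] at this ⊢

lemma interior_eq_empty_of_finite {K : Set unitInterval} (hK : K.Finite) : interior K = ∅ := by
  refine interior_eq_empty_iff_dense_compl.2 (dense_compl_of_countable ?_ hK.countable)
  exact fun x => inferInstance

lemma exists_homeomorph_vertices {B : Set HilbertCube} (hB : IsCantorSet B) :
    ∃ h : HilbertCube ≃ₜ HilbertCube, h '' range cubeVertex ⊆ B := by
  obtain ⟨f, hf, hfi, rfl⟩ := hB.exists_param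
  have hfin : ({0, 1} : Set unitInterval).Finite := by simp
  obtain ⟨h, hh⟩ := exists_homeomorph_product_into_range (K := fun _ => {0, 1})
    (fun _ => hfin.isClosed) (fun _ => interior_eq_empty_of_finite hfin) hf hfi
  refine ⟨h, ?_⟩
  rintro _ ⟨_, ⟨c, rfl⟩, rfl⟩
  refine hh _ fun i => ?_
  simp only [cubeVertex]
  split_ifs <;> simp

lemma isMinimalCantorSet_image_vertices (h : HilbertCube ≃ₜ HilbertCube) :
    IsMinimalCantorSet (h '' range cubeVertex) := by
  refine ⟨?_, fun B hB => ?_⟩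
  · rw [← range_comp]
    exact isCantorSet_range (h.continuous.comp continuous_cubeVertex)
      (h.injective.comp cubeVertex_injective)
  · obtain ⟨k, hk⟩ := exists_homeomorph_vertices hB
    refine ⟨h.symm.trans k, ?_⟩
    rintro _ ⟨_, ⟨x, hx, rfl⟩, rfl⟩
    simpa using hk ⟨x, hx, rfl⟩

lemma product_mem_sigmaC0 {K : ℕ → Set unitInterval}
    (hK : ∀ i, IsClosed (K i)) (hn : ∀ i, interior (K i) = ∅) :
    {x : HilbertCube | ∀ i, x i ∈ K i} ∈ sigmaC0 := by
  obtain ⟨h, hh⟩ := exists_homeomorph_product_into_range hK hn continuous_cubeVertex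
    cubeVertex_injective
  refine ⟨fun _ => h.symm '' range cubeVertex, fun _ => isMinimalCantorSet_image_vertices _, ?_⟩
  intro x hx
  refine mem_iUnion.2 ⟨0, h x, hh x hx, by simp⟩

lemma isClosed_range_cubeVertex : IsClosed (range cubeVertex) :=
  (isCompact_range continuous_cubeVertex).isClosed

lemma interior_range_cubeVertex : interior (range cubeVertex) = ∅ := by
  refine interior_eq_empty_iff_dense_compl.2 ?_
  have hd : Dense ((fun x : HilbertCube => x 0) ⁻¹' ({0, 1} : Set unitInterval)ᶜ) :=
    Dense.preimage (interior_eq_empty_iff_dense_compl.1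
      (interior_eq_empty_of_finite (by simp))) (isOpenMap_eval 0)
  refine hd.mono ?_
  rintro x hx ⟨c, rfl⟩
  refine hx ?_
  simp only [cubeVertex]
  split_ifs <;> simp

lemma sigmaC0_subset_meager : sigmaC0 ⊆ MeagerIdeal HilbertCube := by
  rintro A ⟨S, hS, hA⟩
  refine IsMeagre.mono hA (isMeagre_iUnion fun n => ?_)
  obtain ⟨h, hh⟩ := (hS n).2 _ (isCantorSet_range continuous_cubeVertex cubeVertex_injective)
  have hsub : S n ⊆ h ⁻¹' range cubeVertex := image_subset_iff.1 hh
  refine IsMeagre.mono hsub (IsNowhereDense.isMeagre ?_)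
  have hcl : IsClosed (h ⁻¹' range cubeVertex) := isClosed_range_cubeVertex.preimage h.continuous
  rw [IsNowhereDense, hcl.closure_eq, ← h.preimage_interior, interior_range_cubeVertex,
    preimage_empty]

/-! ### Digit expansions -/

/-- Two sequences agreeing below `n` form a neighbourhood basis of the sequence space. -/
lemma exists_cylinder_subset {α : Type*} [TopologicalSpace α] [DiscreteTopology α]
    {U : Set (ℕ → α)} (hU : IsOpen U) {d : ℕ → α} (hd : d ∈ U) :
    ∃ n, ∀ y : ℕ → α, (∀ i < n, y i = d i) → y ∈ U := by
  obtain ⟨I, u, hu, hsub⟩ := isOpen_pi_iff.1 hU d hd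
  refine ⟨I.sup id + 1, fun y hy => hsub fun i hi => ?_⟩
  rw [hy i (Nat.lt_succ_of_le (Finset.le_sup (f := id) hi))]
  exact (hu i hi).2

/-- The map sending a sequence of digits to the real number it represents. -/
noncomputable def digitMap (N : ℕ) (y : ℕ → Fin N) : unitInterval :=
  ⟨Real.ofDigits y, Real.ofDigits_nonneg y, Real.ofDigits_le_one y⟩

lemma continuous_digitMap (N : ℕ) : Continuous (digitMap N) :=
  Continuous.subtype_mk Real.continuous_ofDigits _

lemma digitMap_surjective {N : ℕ} (hN : 1 < N) : Function.Surjective (digitMap N) := by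
  intro x
  obtain ⟨y, -, hy⟩ := Real.ofDigits_SurjOn hN x.2
  exact ⟨y, Subtype.ext hy⟩

lemma ofDigits_eq_div {N : ℕ} (y : ℕ → Fin N) :
    Real.ofDigits y = ((y 0 : ℕ) + Real.ofDigits fun i => y (i + 1)) / N := by
  have h := Real.ofDigits_eq_sum_add_ofDigits y 1
  simp only [Finset.sum_range_one, Real.ofDigitsTerm] at h
  rw [h]
  simp
  ring

lemma exists_Ioo_digits {N : ℕ} (hN : 1 < N) (n : ℕ) : ∀ d : ℕ → Fin N,
    ∃ O : Set ℝ, IsOpen O ∧ O.Nonempty ∧ O ⊆ Ioo 0 1 ∧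
      ∀ y : ℕ → Fin N, Real.ofDigits y ∈ O → ∀ i < n, y i = d i := by
  induction n with
  | zero => exact fun d => ⟨Ioo 0 1, isOpen_Ioo, ⟨1 / 2, by norm_num⟩, le_rfl, by simp⟩
  | succ n ih =>
    intro d
    obtain ⟨O, hO, ⟨t, ht⟩, hsub, hdig⟩ := ih fun i => d (i + 1)
    have hN0 : (0 : ℝ) < N := by positivity
    refine ⟨(fun x : ℝ => N * x - (d 0 : ℕ)) ⁻¹' O, hO.preimage (by fun_prop),
      ⟨(t + (d 0 : ℕ)) / N, ?_⟩, ?_, ?_⟩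
    · have : (N : ℝ) * ((t + (d 0 : ℕ)) / N) - (d 0 : ℕ) = t := by field_simp; ring
      simpa only [mem_preimage, this] using ht
    · intro x hx
      have h := hsub hx
      have hd : ((d 0 : ℕ) : ℝ) + 1 ≤ N := by exact_mod_cast (d 0).2
      have hd0 : (0 : ℝ) ≤ (d 0 : ℕ) := Nat.cast_nonneg _
      have h1 := h.1
      have h2 := h.2
      constructor
      · by_contra hcon
        push Not at hcon
        nlinarith
      · by_contra hcon
        push Not at hcon
        nlinarith
    · intro y hy
      set T := Real.ofDigits fun i => y (i + 1) with hT
      have e : (N : ℝ) * Real.ofDigits y = (y 0 : ℕ) + T := by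
        rw [ofDigits_eq_div y]; field_simp; rfl
      have hy' : ((y 0 : ℕ) : ℝ) + T - (d 0 : ℕ) ∈ O := by
        rw [← e]; exact hy
      have hI := hsub hy'
      have hT0 : 0 ≤ T := Real.ofDigits_nonneg _
      have hT1 : T ≤ 1 := Real.ofDigits_le_one _
      have h1 := hI.1
      have h2 := hI.2
      have hle : (y 0 : ℕ) ≤ (d 0 : ℕ) := by
        have : ((y 0 : ℕ) : ℝ) < (d 0 : ℕ) + 1 := by linarith
        exact_mod_cast Nat.lt_succ_iff.1 (by exact_mod_cast this)
      have hge : (d 0 : ℕ) ≤ (y 0 : ℕ) := by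
        have : ((d 0 : ℕ) : ℝ) < (y 0 : ℕ) + 1 := by linarith
        exact_mod_cast Nat.lt_succ_iff.1 (by exact_mod_cast this)
      have h0 : y 0 = d 0 := Fin.ext (le_antisymm hle hge)
      rw [h0, add_sub_cancel_left] at hy'
      intro i hi
      cases i with
      | zero => exact h0
      | succ i => exact hdig _ hy' i (by omega)

lemma exists_isOpen_digits {N : ℕ} (hN : 1 < N) (n : ℕ) (d : ℕ → Fin N) :
    ∃ O : Set unitInterval, IsOpen O ∧ O.Nonempty ∧
      ∀ y : ℕ → Fin N, digitMap N y ∈ O → ∀ i < n, y i = d i := by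
  obtain ⟨O, hO, ⟨t, ht⟩, hsub, hdig⟩ := exists_Ioo_digits hN n d
  exact ⟨Subtype.val ⁻¹' O, hO.preimage continuous_subtype_val,
    ⟨⟨t, Ioo_subset_Icc_self (hsub ht)⟩, ht⟩, fun y hy => hdig y hy⟩

lemma interior_image_digitMap {N : ℕ} (hN : 1 < N) {K : Set (ℕ → Fin N)} (hK : IsClosed K)
    (hn : interior K = ∅) : interior (digitMap N '' K) = ∅ := by
  by_contra hne
  obtain ⟨x, hx⟩ := nonempty_iff_ne_empty.2 hne
  obtain ⟨y, rfl⟩ := digitMap_surjective hN x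
  obtain ⟨d, hdV, hdK⟩ := (interior_eq_empty_iff_dense_compl.1 hn).inter_open_nonempty _
    (isOpen_interior.preimage (continuous_digitMap N)) ⟨y, hx⟩
  have hW : IsOpen (digitMap N ⁻¹' interior (digitMap N '' K) ∩ Kᶜ) :=
    (isOpen_interior.preimage (continuous_digitMap N)).inter hK.isOpen_compl
  obtain ⟨n, hcyl⟩ := exists_cylinder_subset hW ⟨hdV, hdK⟩
  obtain ⟨O, -, ⟨t, ht⟩, hO⟩ := exists_isOpen_digits hN n d
  obtain ⟨w, rfl⟩ := digitMap_surjective hN t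
  have hw := hcyl w (hO w ht)
  obtain ⟨k, hkK, hk⟩ := interior_subset hw.1
  rw [← hk] at ht
  exact (hcyl k (hO k ht)).2 hkK

lemma covIdeal_sigmaC0_le_of_digit_cover {N : ℕ} (hN : 1 < N) {T : Type}
    {K : T → ℕ → Set (ℕ → Fin N)} (hK : ∀ t i, IsClosed (K t i))
    (hn : ∀ t i, interior (K t i) = ∅)
    (hcov : ∀ x : ℕ → ℕ → Fin N, ∃ t, ∀ i, x i ∈ K t i) : covIdeal sigmaC0 ≤ #T := by
  let C : T → Set HilbertCube := fun t => {x | ∀ i, x i ∈ digitMap N '' K t i}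
  have hC : ∀ t, C t ∈ sigmaC0 := fun t => product_mem_sigmaC0
    (fun i => ((hK t i).isCompact.image (continuous_digitMap N)).isClosed)
    (fun i => interior_image_digitMap hN (hK t i) (hn t i))
  have hCu : ⋃₀ range C = Set.univ := eq_univ_of_forall fun x => ?_
  · exact (csInf_le' ⟨range C, range_subset_iff.2 hC, hCu, rfl⟩ :
      covIdeal sigmaC0 ≤ #(range C)).trans mk_range_le
  choose y hy using fun i => digitMap_surjective hN (x i)
  obtain ⟨t, ht⟩ := hcov y
  exact ⟨C t, mem_range_self t, fun i => ⟨y i, ht i, hy i⟩⟩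

/-- The sequences that do not follow the pattern `σ` on any of the given blocks. -/
def avoidPattern {α : Type*} (σ : ℕ → α) (S : Set ℕ) (lo hi : ℕ → ℕ) : Set (ℕ → α) :=
  {y | ∀ k ∈ S, ∃ t, lo k ≤ t ∧ t < hi k ∧ y t ≠ σ t}

lemma isClosed_avoidPattern {α : Type*} [TopologicalSpace α] [DiscreteTopology α] (σ : ℕ → α)
    (S : Set ℕ) (lo hi : ℕ → ℕ) : IsClosed (avoidPattern σ S lo hi) := by
  have : avoidPattern σ S lo hi =
      ⋂ k ∈ S, ⋃ t ∈ Finset.Ico (lo k) (hi k), (fun y : ℕ → α => y t) ⁻¹' {σ t}ᶜ := by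
    ext y
    simp [avoidPattern, and_assoc]
  rw [this]
  refine isClosed_biInter fun k _ => isClosed_biUnion_finset fun t _ => ?_
  exact (isClosed_discrete _).preimage (continuous_apply t)

lemma interior_avoidPattern {α : Type*} [TopologicalSpace α] [DiscreteTopology α] {σ : ℕ → α}
    {S : Set ℕ} {lo hi : ℕ → ℕ} (hS : ∀ m, ∃ k ∈ S, m ≤ lo k) :
    interior (avoidPattern σ S lo hi) = ∅ := by
  by_contra hne
  obtain ⟨y, hy⟩ := nonempty_iff_ne_empty.2 hne
  obtain ⟨n, hn⟩ := exists_cylinder_subset isOpen_interior hy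
  obtain ⟨k, hk, hnk⟩ := hS n
  have := interior_subset (hn (fun t => if t < n then y t else σ t) fun i hi => if_pos hi)
  obtain ⟨t, ht, -, hne⟩ := this k hk
  exact hne (if_neg (by omega))

/-- A parametrization of the Hilbert cube by binary sequences. -/
noncomputable def binaryCube (z : ℕ → Fin 2) : HilbertCube := fun i =>
  digitMap 2 fun n => z (Nat.pair i n)

lemma continuous_binaryCube : Continuous binaryCube := by
  refine continuous_pi fun i => (continuous_digitMap 2).comp ?_
  fun_prop

lemma binaryCube_surjective : Function.Surjective binaryCube := by
  intro x
  choose y hy using fun i => digitMap_surjective one_lt_two (x i)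
  refine ⟨fun m => y m.unpair.1 m.unpair.2, ?_⟩
  funext i
  simp only [binaryCube, Nat.unpair_pair]
  exact hy i

/-- A set of sequences is avoidable if every finite sequence has a finite extension all of whose
continuations lie outside of the set. -/
def Avoidable (P : Set (ℕ → Fin 2)) : Prop :=
  ∀ (d : ℕ → Fin 2) (n : ℕ), ∃ (d' : ℕ → Fin 2) (n' : ℕ), n ≤ n' ∧ (∀ i < n, d' i = d i) ∧
    ∀ z : ℕ → Fin 2, (∀ i < n', z i = d' i) → z ∉ P

lemma Avoidable.union {P R : Set (ℕ → Fin 2)} (hP : Avoidable P) (hR : Avoidable R) :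
    Avoidable (P ∪ R) := by
  intro d n
  obtain ⟨d₁, n₁, h₁, a₁, b₁⟩ := hP d n
  obtain ⟨d₂, n₂, h₂, a₂, b₂⟩ := hR d₁ n₁
  refine ⟨d₂, n₂, h₁.trans h₂, fun i hi => (a₂ i (by omega)).trans (a₁ i hi), fun z hz h => ?_⟩
  rcases h with h | h
  · exact b₁ z (fun i hi => (hz i (by omega)).trans (a₂ i hi)) h
  · exact b₂ z hz h

lemma avoidable_preimage_binaryCube {F : Set HilbertCube} (hF : IsNowhereDense F) :
    Avoidable (binaryCube ⁻¹' F) := by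
  intro d n
  choose O hO hOne hOd using fun i : ℕ =>
    exists_isOpen_digits one_lt_two n (fun k => d (Nat.pair i k))
  have hbox : IsOpen (Set.pi (Finset.range n : Set ℕ) O) :=
    isOpen_set_pi (Finset.finite_toSet _) fun i _ => hO i
  have hd : Dense (closure F)ᶜ := interior_eq_empty_iff_dense_compl.1 hF
  obtain ⟨x, hx, hxF⟩ := hd.inter_open_nonempty _ hbox
    ⟨fun i => (hOne i).some, fun i _ => (hOne i).some_mem⟩
  obtain ⟨d', rfl⟩ := binaryCube_surjective x
  obtain ⟨n', hn'⟩ := exists_cylinder_subset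
    (isClosed_closure.isOpen_compl.preimage continuous_binaryCube) hxF
  refine ⟨d', max n n', le_max_left _ _, fun m hm => ?_, fun z hz hzF => ?_⟩
  · have h1 := Nat.unpair_left_le m
    have h2 := Nat.unpair_right_le m
    have := hOd m.unpair.1 (fun k => d' (Nat.pair m.unpair.1 k))
      (hx m.unpair.1 (by simp; omega)) m.unpair.2 (by omega)
    simpa using this
  · exact hn' z (fun i hi => hz i (lt_of_lt_of_le hi (le_max_right _ _))) (subset_closure hzF)

lemma Avoidable.exists_block {P : Set (ℕ → Fin 2)} (hP : Avoidable P) (n : ℕ) :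
    ∃ (w : ℕ → Fin 2) (m : ℕ), n < m ∧
      ∀ z : ℕ → Fin 2, (∀ t, n ≤ t → t < m → z t = w t) → z ∉ P := by
  have key : ∀ S : Finset (Fin n → Fin 2), ∃ (w : ℕ → Fin 2) (m : ℕ), n < m ∧
      ∀ z : ℕ → Fin 2, (fun i : Fin n => z i) ∈ S →
        (∀ t, n ≤ t → t < m → z t = w t) → z ∉ P := by
    intro S
    induction S using Finset.induction_on with
    | empty => exact ⟨fun _ => 0, n + 1, Nat.lt_succ_self n, by simp⟩
    | insert p S _ ih =>
      obtain ⟨w, m, hm, hw⟩ := ih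
      obtain ⟨d', m', hm', ha, hb⟩ := hP (fun t => if h : t < n then p ⟨t, h⟩ else w t) m
      refine ⟨d', m', by omega, fun z hz hzd => ?_⟩
      rcases Finset.mem_insert.1 hz with h | h
      · refine hb z fun i hi => ?_
        rcases lt_or_ge i n with hin | hin
        · rw [ha i (by omega), dif_pos hin, ← h]
        · exact hzd i hin hi
      · refine hw z h fun t ht htm => ?_
        rw [hzd t ht (by omega), ha t htm, dif_neg (by omega)]
  obtain ⟨w, m, hm, h⟩ := key Finset.univ
  exact ⟨w, m, hm, fun z hz => h z (Finset.mem_univ _) hz⟩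

/-- The index of the interval of the partition given by `q` containing `t`. -/
def partIndex (q : ℕ → ℕ) (t : ℕ) : ℕ := Nat.findGreatest (fun k => q k ≤ t) t

lemma partIndex_eq {q : ℕ → ℕ} (hq : StrictMono q) {t k : ℕ} (h1 : q k ≤ t) (h2 : t < q (k + 1)) :
    partIndex q t = k := by
  rw [partIndex, Nat.findGreatest_eq_iff]
  refine ⟨(hq.id_le k).trans h1, fun _ => h1, fun n hkn _ hn => ?_⟩
  have := hq.monotone (show k + 1 ≤ n from hkn)
  omega

lemma partIndex_spec {q : ℕ → ℕ} (hq : StrictMono q) (h0 : q 0 = 0) (t : ℕ) :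
    q (partIndex q t) ≤ t ∧ t < q (partIndex q t + 1) := by
  have h1 : q (partIndex q t) ≤ t :=
    Nat.findGreatest_spec (P := fun k => q k ≤ t) (Nat.zero_le t) (by omega)
  refine ⟨h1, ?_⟩
  by_contra hcon
  push Not at hcon
  have := Nat.le_findGreatest (P := fun k => q k ≤ t) ((hq.id_le _).trans hcon) hcon
  exact absurd this (by change ¬ partIndex q t + 1 ≤ partIndex q t; omega)

/-- Every meager set is avoided by all sequences that follow a suitable pattern on infinitely
many blocks. -/
theorem exists_pattern_of_isMeagre {A : Set HilbertCube} (hA : IsMeagre A) :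
    ∃ (w : ℕ → Fin 2) (j : ℕ → ℕ), ∀ z : ℕ → Fin 2,
      (∀ m, ∃ n, m ≤ n ∧ ∀ t, n ≤ t → t < j n → z t = w t) → binaryCube z ∉ A := by
  obtain ⟨S, hS, hSc, hAS⟩ := isMeagre_iff_countable_union_isNowhereDense.1 hA
  obtain ⟨F, hF⟩ : ∃ F : ℕ → Set HilbertCube, (∀ k, IsNowhereDense (F k)) ∧ A ⊆ ⋃ k, F k := by
    rcases S.eq_empty_or_nonempty with rfl | hne
    · exact ⟨fun _ => ∅, fun _ => by simp, by simpa using hAS⟩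
    · obtain ⟨F, rfl⟩ := hSc.exists_eq_range hne
      exact ⟨F, fun k => hS _ (mem_range_self k), by simpa using hAS⟩
  obtain ⟨hFn, hAF⟩ := hF
  have hav : ∀ k, Avoidable (⋃ l ∈ Finset.range (k + 1), binaryCube ⁻¹' F l) := by
    intro k
    induction k with
    | zero => simpa using avoidable_preimage_binaryCube (hFn 0)
    | succ k ih =>
      rw [Finset.range_add_one, Finset.set_biUnion_insert]
      exact (avoidable_preimage_binaryCube (hFn _)).union ih
  choose w m hm hw using fun k n => (hav k).exists_block n
  let ν : ℕ → ℕ := fun k => Nat.rec 0 (fun k n => m k n) k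
  have hν : ∀ k, ν (k + 1) = m k (ν k) := fun k => rfl
  have hνm : StrictMono ν := strictMono_nat_of_lt_succ fun k => by rw [hν]; exact hm _ _
  refine ⟨fun t => w (partIndex ν t) (ν (partIndex ν t)) t, fun n => ν (n + 1), fun z hz hzA => ?_⟩
  obtain ⟨l, hl⟩ := mem_iUnion.1 (hAF hzA)
  obtain ⟨n, hn, hzn⟩ := hz l
  refine hw n (ν n) z (fun t ht htm => ?_) (mem_biUnion (Finset.mem_range.2 (by omega)) hl)
  rw [← hν] at htm
  rw [hzn t ((hνm.id_le n).trans ht) htm]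
  simp only [partIndex_eq hνm ht htm]

/-! ### Combinatorics of partitions -/

/-- An undominated function yields an interval partition that is infinitely often coarser than
any function in the family. -/
lemma exists_partition_of_undominated {ι : Type} {g : ι → ℕ → ℕ} {h : ℕ → ℕ}
    (hh : ∀ a m, ∃ n, m ≤ n ∧ g a n ≤ h n) :
    ∃ q : ℕ → ℕ, StrictMono q ∧ q 0 = 0 ∧
      ∀ a m, ∃ l n, m ≤ l ∧ q l ≤ n ∧ n < q (l + 1) ∧ g a n ≤ q (l + 2) := by
  let H : ℕ → ℕ := fun n => (Finset.range (n + 1)).sup h + n + 1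
  have hH : ∀ n k, n ≤ k → h n ≤ H k := fun n k hnk => by
    have : h n ≤ (Finset.range (k + 1)).sup h :=
      Finset.le_sup (f := h) (Finset.mem_range.2 (by omega))
    simp only [H]; omega
  let q : ℕ → ℕ := fun k => Nat.rec 0 (fun _ n => H n) k
  have hqs : ∀ k, q (k + 1) = H (q k) := fun _ => rfl
  have hq : StrictMono q := strictMono_nat_of_lt_succ fun k => by rw [hqs]; simp only [H]; omega
  refine ⟨q, hq, rfl, fun a m => ?_⟩
  obtain ⟨n, hmn, hn⟩ := hh a (q m)
  obtain ⟨h1, h2⟩ := partIndex_spec hq rfl n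
  refine ⟨partIndex q n, n, ?_, h1, h2, hn.trans ?_⟩
  · by_contra hcon
    push Not at hcon
    have := hq.monotone (show partIndex q n + 1 ≤ m from hcon)
    omega
  · rw [hqs (partIndex q n + 1)]
    exact hH _ _ h2.le

/-- Greedy choice of distinct representatives for sets that are large enough. -/
lemma exists_labelling (Y : ℕ → Finset ℕ) (k : ℕ) :
    ∃ c : ℕ → ℕ, ∀ i ≤ k, k + 1 ≤ (Y i).card → ∃ l ∈ Y i, c l = i := by
  have key : ∀ m ≤ k + 1, ∃ (f : ℕ → ℕ), ∀ i < m, k + 1 ≤ (Y i).card →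
      f i ∈ Y i ∧ ∀ i' < i, k + 1 ≤ (Y i').card → f i' ≠ f i := by
    intro m
    induction m with
    | zero => exact fun _ => ⟨id, by simp⟩
    | succ m ih =>
      intro hm
      obtain ⟨f, hf⟩ := ih (by omega)
      by_cases hY : k + 1 ≤ (Y m).card
      · have hcard : ((Finset.range m).image f).card < (Y m).card := by
          have := Finset.card_image_le (s := Finset.range m) (f := f)
          rw [Finset.card_range] at this
          omega
        obtain ⟨l, hl, hlf⟩ := Finset.exists_mem_notMem_of_card_lt_card hcard
        have hlf' : ∀ i < m, f i ≠ l := fun i hi e =>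
          hlf (Finset.mem_image.2 ⟨i, Finset.mem_range.2 hi, e⟩)
        refine ⟨Function.update f m l, fun i hi hYi => ?_⟩
        rcases Nat.lt_succ_iff_lt_or_eq.1 hi with him | rfl
        · rw [Function.update_of_ne him.ne]
          refine ⟨(hf i him hYi).1, fun i' hi' h' => ?_⟩
          rw [Function.update_of_ne (by omega)]
          exact (hf i him hYi).2 i' hi' h'
        · rw [Function.update_self]
          refine ⟨hl, fun i' hi' _ => ?_⟩
          rw [Function.update_of_ne hi'.ne]
          exact hlf' i' hi'
      · refine ⟨f, fun i hi hYi => ?_⟩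
        rcases Nat.lt_succ_iff_lt_or_eq.1 hi with him | rfl
        · exact hf i him hYi
        · exact absurd hYi hY
  obtain ⟨f, hf⟩ := key (k + 1) le_rfl
  classical
  let good : ℕ → ℕ → Prop := fun l i => i ≤ k ∧ k + 1 ≤ (Y i).card ∧ f i = l
  refine ⟨fun l => if h : ∃ i, good l i then h.choose else 0, fun i hi hY => ?_⟩
  refine ⟨f i, (hf i (by omega) hY).1, ?_⟩
  have hex : ∃ i', good (f i) i' := ⟨i, hi, hY, rfl⟩
  simp only [dif_pos hex]
  obtain ⟨h1, h2, h3⟩ := hex.choose_spec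
  rcases lt_trichotomy hex.choose i with h | h | h
  · exact absurd h3 ((hf i (by omega) hY).2 _ h h2)
  · exact h
  · exact absurd h3.symm ((hf _ (by omega) h2).2 _ h hY)

lemma exists_card_filter_Ico {Y : ℕ → Prop} [DecidablePred Y] (hY : ∀ m, ∃ l, m ≤ l ∧ Y l)
    (n c : ℕ) : ∃ M, c ≤ ((Finset.Ico n M).filter Y).card := by
  induction c with
  | zero => exact ⟨0, Nat.zero_le _⟩
  | succ c ih =>
    obtain ⟨M, hM⟩ := ih
    obtain ⟨l, hl, hYl⟩ := hY (max n M)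
    refine ⟨l + 1, ?_⟩
    have hsub : insert l ((Finset.Ico n M).filter Y) ⊆ (Finset.Ico n (l + 1)).filter Y := by
      intro x hx
      rcases Finset.mem_insert.1 hx with rfl | hx
      · simp only [Finset.mem_filter, Finset.mem_Ico]
        exact ⟨⟨le_trans (le_max_left _ _) hl, Nat.lt_succ_self _⟩, hYl⟩
      · simp only [Finset.mem_filter, Finset.mem_Ico] at hx ⊢
        have := le_trans (le_max_right _ _) hl
        exact ⟨⟨hx.1.1, by omega⟩, hx.2⟩
    have := Finset.card_le_card hsub
    rw [Finset.card_insert_of_notMem] at this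
    · omega
    · simp only [Finset.mem_filter, Finset.mem_Ico, not_and]
      have := le_trans (le_max_right _ _) hl
      intro h; omega

/-- The undominated case: a cover by products over a three-letter alphabet. -/
theorem covIdeal_sigmaC0_le_of_undominated {ι : Type} (w : ι → ℕ → Fin 2) (j : ι → ℕ → ℕ)
    (hcov : ∀ z : ℕ → Fin 2, ∃ a, ¬ ∀ m, ∃ n, m ≤ n ∧ ∀ t, n ≤ t → t < j a n → z t = w a t)
    (hund : ∀ g : ι → ℕ → ℕ, ∃ h : ℕ → ℕ, ∀ a m, ∃ n, m ≤ n ∧ g a n ≤ h n) :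
    covIdeal sigmaC0 ≤ #(ι × ℕ) := by
  classical
  obtain ⟨h₁, hh₁⟩ := hund fun a n => max (j a n) (j a (j a n))
  obtain ⟨q, hq, hq0, hqj⟩ := exists_partition_of_undominated hh₁
  let Y : ι → ℕ → Prop := fun a l => ∃ n, q l ≤ n ∧ j a n ≤ q (l + 1)
  have hY : ∀ a m, ∃ l, m ≤ l ∧ Y a l := by
    intro a m
    obtain ⟨l, n, hml, h1, h2, h3⟩ := hqj a m
    rcases le_or_gt (j a n) (q (l + 1)) with h | h
    · exact ⟨l, hml, n, h1, h⟩
    · exact ⟨l + 1, by omega, j a n, h.le, (le_max_right _ _).trans h3⟩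
  choose G hG using fun a n => exists_card_filter_Ico (hY a) n (2 * (n + 2))
  obtain ⟨h₂, hh₂⟩ := hund G
  obtain ⟨s, hs, hs0, hsG⟩ := exists_partition_of_undominated hh₂
  let X : ι → ℕ → Prop := fun a k => k + 1 ≤ ((Finset.Ico (s k) (s (k + 1))).filter (Y a)).card
  have hX : ∀ a m, ∃ k, m ≤ k ∧ X a k := by
    intro a m
    obtain ⟨k, n, hmk, h1, h2, h3⟩ := hsG a m
    have hkn : k ≤ n := (hs.id_le k).trans h1
    have hsub : (Finset.Ico n (G a n)).filter (Y a) ⊆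
        (Finset.Ico (s k) (s (k + 1))).filter (Y a) ∪
          (Finset.Ico (s (k + 1)) (s (k + 2))).filter (Y a) := by
      intro x hx
      simp only [Finset.mem_union, Finset.mem_filter, Finset.mem_Ico] at hx ⊢
      rcases lt_or_ge x (s (k + 1)) with h | h
      · exact Or.inl ⟨⟨by omega, h⟩, hx.2⟩
      · exact Or.inr ⟨⟨h, by omega⟩, hx.2⟩
    have hc := (hG a n).trans ((Finset.card_le_card hsub).trans (Finset.card_union_le _ _))
    by_cases hk : X a k
    · exact ⟨k, hmk, hk⟩
    · refine ⟨k + 1, by omega, ?_⟩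
      simp only [X] at hk
      change k + 1 + 1 ≤ ((Finset.Ico (s (k + 1)) (s (k + 2))).filter (Y a)).card
      omega
  let σ : ι → ℕ → Fin 3 := fun a t => if Y a (partIndex q t) then Fin.castSucc (w a t) else 2
  let lo : ℕ → ℕ := fun k => q (s k)
  let hi : ℕ → ℕ := fun k => q (s (k + 1))
  refine covIdeal_sigmaC0_le_of_digit_cover (N := 3) (by norm_num) (T := ι × ℕ)
    (K := fun p i => avoidPattern (σ p.1) {k | max i p.2 ≤ k ∧ X p.1 k} lo hi)
    (fun _ _ => isClosed_avoidPattern _ _ _ _) (fun p i => interior_avoidPattern fun m => ?_) ?_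
  · obtain ⟨k, hk, hXk⟩ := hX p.1 (max m (max i p.2))
    refine ⟨k, ⟨(le_max_right _ _).trans hk, hXk⟩, ?_⟩
    exact ((le_max_left _ _).trans hk).trans ((hs.id_le k).trans (hq.id_le _))
  intro x
  by_contra hcon
  have hx : ∀ a n, ∃ k i, n ≤ k ∧ i ≤ k ∧ X a k ∧ ∀ t, lo k ≤ t → t < hi k → x i t = σ a t := by
    intro a n
    by_contra hno
    refine hcon ⟨(a, n), fun i k hk => ?_⟩
    by_contra hne
    push Not at hne
    exact hno ⟨k, i, (le_max_right _ _).trans hk.1, (le_max_left _ _).trans hk.1, hk.2, hne⟩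
  let B : ℕ → ℕ → Finset ℕ := fun k i =>
    (Finset.Ico (s k) (s (k + 1))).filter fun l => ∀ t, q l ≤ t → t < q (l + 1) → x i t ≠ 2
  choose c hc using fun k => exists_labelling (B k) k
  let lab : ℕ → ℕ := fun l => c (partIndex s l) l
  let ρ : Fin 3 → Fin 2 := fun v => if v = 1 then 1 else 0
  have hρ : ∀ b : Fin 2, ρ (Fin.castSucc b) = b := by decide
  obtain ⟨a, ha⟩ := hcov fun t => ρ (x (lab (partIndex q t)) t)
  refine ha fun m => ?_
  obtain ⟨k, i, hmk, hik, hXk, hxσ⟩ := hx a m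
  have hmem : ∀ l, s k ≤ l → l < s (k + 1) → ∀ t, q l ≤ t → t < q (l + 1) →
      x i t = if Y a l then Fin.castSucc (w a t) else 2 := by
    intro l h1 h2 t h3 h4
    rw [hxσ t ((hq.monotone h1).trans h3) (h4.trans_le (hq.monotone h2))]
    simp only [σ, partIndex_eq hq h3 h4]
  have hB : B k i = (Finset.Ico (s k) (s (k + 1))).filter (Y a) := by
    ext l
    simp only [B, Finset.mem_filter, Finset.mem_Ico]
    refine and_congr_right fun hl => ⟨fun h => ?_, fun h t h3 h4 => ?_⟩
    · by_contra hYl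
      refine h (q l) le_rfl (hq (Nat.lt_succ_self l)) ?_
      rw [hmem l hl.1 hl.2 _ le_rfl (hq (Nat.lt_succ_self l)), if_neg hYl]
    · rw [hmem l hl.1 hl.2 t h3 h4, if_pos h]
      exact (Fin.castSucc_lt_last _).ne
  obtain ⟨l, hl, hcl⟩ := hc k i hik (by rw [hB]; exact hXk)
  rw [hB] at hl
  simp only [Finset.mem_filter, Finset.mem_Ico] at hl
  obtain ⟨⟨hl1, hl2⟩, n, hn1, hn2⟩ := hl
  refine ⟨n, ?_, fun t ht1 ht2 => ?_⟩
  · exact hmk.trans ((hs.id_le k).trans (hl1.trans ((hq.id_le l).trans hn1)))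
  · have h3 : q l ≤ t := hn1.trans ht1
    have h4 : t < q (l + 1) := ht2.trans_le hn2
    have hlab : lab (partIndex q t) = i := by
      simp only [lab, partIndex_eq hq h3 h4, partIndex_eq hs hl1 hl2, hcl]
    simp only [hlab]
    rw [hmem l hl1 hl2 t h3 h4, if_pos ⟨n, hn1, hn2⟩, hρ]

/-- Eventual equality of binary sequences. -/
def eventualEq : Setoid (ℕ → Fin 2) where
  r x y := ∃ n, ∀ t, n ≤ t → x t = y t
  iseqv := ⟨fun _ => ⟨0, fun _ _ => rfl⟩, fun ⟨n, h⟩ => ⟨n, fun t ht => (h t ht).symm⟩,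
    fun ⟨n, h⟩ ⟨m, h'⟩ => ⟨max n m, fun t ht => (h t (by omega)).trans (h' t (by omega))⟩⟩

lemma countable_eventualEq_class (x : ℕ → Fin 2) :
    {y : ℕ → Fin 2 | ∃ n, ∀ t, n ≤ t → y t = x t}.Countable := by
  have : {y : ℕ → Fin 2 | ∃ n, ∀ t, n ≤ t → y t = x t} =
      ⋃ n, {y : ℕ → Fin 2 | ∀ t, n ≤ t → y t = x t} := by ext; simp
  rw [this]
  refine countable_iUnion fun n => ?_
  refine (Set.Finite.of_injOn (f := fun (y : ℕ → Fin 2) (i : Fin n) => y i)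
    (t := Set.univ) (fun _ _ => mem_univ _) ?_ Set.finite_univ).countable
  intro y hy y' hy' h
  funext t
  rcases lt_or_ge t n with ht | ht
  · exact congrFun h ⟨t, ht⟩
  · rw [hy t ht, hy' t ht]

lemma not_countable_quotient_eventualEq : ¬ Countable (Quotient eventualEq) := by
  intro hc
  have h : (Set.univ : Set (ℕ → Fin 2)) = ⋃ c : Quotient eventualEq,
      {y | ∃ n, ∀ t, n ≤ t → y t = c.out t} := by
    refine (eq_univ_of_forall fun y => mem_iUnion.2 ⟨Quotient.mk eventualEq y, ?_⟩).symm
    exact eventualEq.symm' (Quotient.mk_out (s := eventualEq) y)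
  have hcount : (Set.univ : Set (ℕ → Fin 2)).Countable := by
    rw [h]
    exact countable_iUnion fun c => countable_eventualEq_class _
  have hle := mk_le_aleph0_iff.2 (Set.countable_univ_iff.1 hcount)
  have hcard : #(ℕ → Fin 2) = 2 ^ ℵ₀ := by simp
  rw [hcard] at hle
  exact absurd (cantor ℵ₀) hle.not_gt

/-- The dominated case: a cover by products of sets of sequences that are often different from
a fixed sequence. -/
theorem covIdeal_sigmaC0_le_of_dominating {ι : Type} (g : ι → ℕ → ℕ)
    (hg : ∀ h : ℕ → ℕ, ∃ a m, ∀ n, m ≤ n → h n < g a n) :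
    covIdeal sigmaC0 ≤ ℵ₁ * #(ι × ℕ) := by
  have hle : ℵ₁ ≤ #(Quotient eventualEq) := by
    rw [← succ_aleph0, Order.succ_le_iff, ← not_le, mk_le_aleph0_iff]
    exact not_countable_quotient_eventualEq
  obtain ⟨W, hW⟩ := le_mk_iff_exists_set.1 hle
  rw [← hW, mul_def]
  refine covIdeal_sigmaC0_le_of_digit_cover (N := 2) one_lt_two (T := W × (ι × ℕ))
    (K := fun p i => avoidPattern p.1.1.out (Ici (max i p.2.2)) id (g p.2.1))
    (fun _ _ => isClosed_avoidPattern _ _ _ _)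
    (fun p i => interior_avoidPattern fun m =>
      ⟨max m (max i p.2.2), mem_Ici.2 (le_max_right _ _), le_max_left _ _⟩) fun x => ?_
  have hnot : ¬ W ⊆ range fun i => Quotient.mk eventualEq (x i) := fun hsub => by
    have := mk_le_aleph0_iff.2 ((countable_range _).mono hsub).to_subtype
    rw [hW] at this
    exact absurd aleph0_lt_aleph_one this.not_gt
  obtain ⟨c, hcW, hc⟩ := not_subset.1 hnot
  have hdiff : ∀ i n, ∃ t, n ≤ t ∧ x i t ≠ c.out t := by
    intro i n
    by_contra hcon
    push Not at hcon
    refine hc ⟨i, ?_⟩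
    rw [← Quotient.out_eq c]
    exact Quotient.sound (s := eventualEq) ⟨n, hcon⟩
  choose next hnext hne using hdiff
  obtain ⟨a, m, ham⟩ := hg fun n => (Finset.range (n + 1)).sup fun i => next i n
  refine ⟨(⟨c, hcW⟩, (a, m)), fun i n hn => ⟨next i n, hnext i n, ?_, hne i n⟩⟩
  have hin : i ≤ n := (le_max_left _ _).trans hn
  exact (Finset.le_sup (f := fun i => next i n) (Finset.mem_range.2 (Nat.lt_succ_of_le hin))).trans_lt
    (ham n ((le_max_right _ _).trans hn))

lemma singleton_mem_sigmaC0 (x : HilbertCube) : {x} ∈ sigmaC0 := by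
  have := product_mem_sigmaC0 (K := fun i => {x i}) (fun _ => isClosed_singleton)
    fun _ => interior_eq_empty_of_finite (finite_singleton _)
  convert this
  ext y
  simp [funext_iff]

lemma sUnion_range_singleton {X : Type*} :
    ⋃₀ range (fun x : X => ({x} : Set X)) = Set.univ :=
  eq_univ_of_forall fun x => ⟨{x}, mem_range_self x, rfl⟩

lemma covIdeal_meager_le : covIdeal (MeagerIdeal HilbertCube) ≤ covIdeal sigmaC0 := by
  refine le_csInf ⟨_, _, range_subset_iff.2 singleton_mem_sigmaC0, sUnion_range_singleton, rfl⟩ ?_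
  rintro _ ⟨A, hA, hAu, rfl⟩
  exact csInf_le' ⟨A, hA.trans sigmaC0_subset_meager, hAu, rfl⟩

lemma aleph_one_le_mk_of_meager_cover {A : Set (Set HilbertCube)}
    (hA : A ⊆ MeagerIdeal HilbertCube) (hAu : ⋃₀ A = Set.univ) : ℵ₁ ≤ #A := by
  rw [← succ_aleph0, Order.succ_le_iff, ← not_le, mk_le_aleph0_iff]
  intro hc
  have : IsMeagre (⋃₀ A) := by
    rw [sUnion_eq_iUnion]
    exact isMeagre_iUnion fun a => hA a.2
  rw [hAu] at this
  exact not_isMeagre_of_isOpen isOpen_univ univ_nonempty this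

lemma covIdeal_sigmaC0_le : covIdeal sigmaC0 ≤ covIdeal (MeagerIdeal HilbertCube) := by
  refine le_csInf ⟨_, _, (range_subset_iff.2 singleton_mem_sigmaC0).trans sigmaC0_subset_meager,
    sUnion_range_singleton, rfl⟩ ?_
  rintro _ ⟨A, hA, hAu, rfl⟩
  have h1 : ℵ₁ ≤ #A := aleph_one_le_mk_of_meager_cover hA hAu
  have h0 : ℵ₀ ≤ #A := aleph0_lt_aleph_one.le.trans h1
  have hprod : #(A × ℕ) = #A := by
    rw [← mul_def, mk_nat, mul_aleph0_eq h0]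
  choose w j hwj using fun a : A => exists_pattern_of_isMeagre (hA a.2)
  have hcov : ∀ z : ℕ → Fin 2,
      ∃ a, ¬ ∀ m, ∃ n, m ≤ n ∧ ∀ t, n ≤ t → t < j a n → z t = w a t := by
    intro z
    obtain ⟨B, hB, hz⟩ : binaryCube z ∈ ⋃₀ A := by rw [hAu]; trivial
    exact ⟨⟨B, hB⟩, fun h => hwj ⟨B, hB⟩ z h hz⟩
  by_cases hund : ∀ g : A → ℕ → ℕ, ∃ h : ℕ → ℕ, ∀ a m, ∃ n, m ≤ n ∧ g a n ≤ h n
  · exact (covIdeal_sigmaC0_le_of_undominated w j hcov hund).trans hprod.le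
  · push Not at hund
    obtain ⟨g, hg⟩ := hund
    refine (covIdeal_sigmaC0_le_of_dominating g hg).trans ?_
    rw [hprod]
    exact mul_le_of_le h0 h1 le_rfl

/-- `cov(σC₀) = cov(M)`. -/
theorem cov_sigmaC0_eq_cov_meager :
    covIdeal sigmaC0 = covIdeal (MeagerIdeal HilbertCube) := by
  exact covIdeal_sigmaC0_le.antisymm covIdeal_meager_le
end
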